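/- arXiv:2010.03511 — 7 statements merged into one kernel-verified Lean document; each statement's English description precedes it below -/
import Mathlib

section
/- Let α be a unital partial action of a finite group G on a C*-algebra A and let d ∈ ℕ. Then dim_Rok(α) ≤ d if and only if for every ε > 0 and every finite subset F ⊆ A there exist positive contractions f_g^(j) ∈ A_g (g ∈ G, j = 0,…,d) satisfying the exact equivariance condition (1') α_g(f_h^(j)·1_{g⁻¹}) = f_{gh}^(j)·1_g for all g, h ∈ G and j = 0,…,d, together with conditions (2), (3) and (4) of the definition of Rokhlin dimension for (F, ε). The analogous equivalence holds for dim_Rok^c ≤ d with condition (5) added. -/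
/-- A partial action of a (discrete) group `G` on a C*-algebra `A`: a family of closed
two-sided (star-closed) ideals `dom g ⊆ A` and *-isomorphisms
`act g : dom g⁻¹ → dom g` (encoded as total maps, with all axioms stated on the domains),
such that `dom 1 = A`, `act 1 = id`, `act g` maps `dom g⁻¹ ∩ dom h` into `dom g ∩ dom (g*h)`,
and `act (g*h)` extends `act g ∘ act h`. -/
structure CStarPartialAction (G : Type*) [Group G] (A : Type*) [NonUnitalCStarAlgebra A] where
  dom : G → Set A
  act : G → A → A
  dom_isClosed : ∀ g, IsClosed (dom g)
  zero_mem : ∀ g, (0 : A) ∈ dom g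
  add_mem : ∀ g, ∀ x ∈ dom g, ∀ y ∈ dom g, x + y ∈ dom g
  smul_mem : ∀ g (c : ℂ), ∀ x ∈ dom g, c • x ∈ dom g
  mul_mem_left : ∀ g (a : A), ∀ x ∈ dom g, a * x ∈ dom g
  mul_mem_right : ∀ g (a : A), ∀ x ∈ dom g, x * a ∈ dom g
  star_mem : ∀ g, ∀ x ∈ dom g, star x ∈ dom g
  dom_one : dom 1 = Set.univ
  act_one : ∀ x, act 1 x = x
  act_mem : ∀ g, ∀ x ∈ dom g⁻¹, act g x ∈ dom g
  act_add : ∀ g, ∀ x ∈ dom g⁻¹, ∀ y ∈ dom g⁻¹, act g (x + y) = act g x + act g y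
  act_smul : ∀ g (c : ℂ), ∀ x ∈ dom g⁻¹, act g (c • x) = c • act g x
  act_mul : ∀ g, ∀ x ∈ dom g⁻¹, ∀ y ∈ dom g⁻¹, act g (x * y) = act g x * act g y
  act_star : ∀ g, ∀ x ∈ dom g⁻¹, act g (star x) = star (act g x)
  act_inv_act : ∀ g, ∀ x ∈ dom g⁻¹, act g⁻¹ (act g x) = x
  act_surjOn : ∀ g, ∀ y ∈ dom g, ∃ x ∈ dom g⁻¹, act g x = y
  act_inter_mem : ∀ g h, ∀ x ∈ dom g⁻¹ ∩ dom h, act g x ∈ dom g ∩ dom (g * h)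
  act_comp : ∀ g h, ∀ x ∈ dom h⁻¹ ∩ dom (g * h)⁻¹, act (g * h) x = act g (act h x)

/-- A positive contraction in a C*-algebra. -/
def IsPosContraction {A : Type*} [NonUnitalCStarAlgebra A] (f : A) : Prop :=
  (∃ b, f = star b * b) ∧ ‖f‖ ≤ 1

variable {G : Type*} [Group G] [Fintype G] {A : Type*} [NonUnitalCStarAlgebra A]

/-- Conditions (1)–(4) of the definition of Rokhlin dimension, for the tolerance `ε` and
finite set `F`. -/
def RokhlinTowers (α : CStarPartialAction G A) (d : ℕ) (F : Finset A) (ε : ℝ)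
    (f : G → Fin (d + 1) → A) : Prop :=
  (∀ g j, f g j ∈ α.dom g ∧ IsPosContraction (f g j)) ∧
  (∀ g h j, ∀ a ∈ F, ∀ x ∈ F, x ∈ α.dom g⁻¹ →
    ‖(α.act g (f h j * x) - f (g * h) j * α.act g x) * a‖ < ε) ∧
  (∀ j, ∀ g h : G, g ≠ h → ∀ a ∈ F, ‖f g j * f h j * a‖ < ε) ∧
  (∀ a ∈ F, ‖(∑ j : Fin (d + 1), ∑ g : G, f g j) * a - a‖ < ε) ∧
  (∀ g j, ∀ a ∈ F, ∀ b ∈ F, ‖(f g j * b - b * f g j) * a‖ < ε)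

/-- Condition (5): approximately commuting towers. -/
def CommutingTowers (d : ℕ) (F : Finset A) (ε : ℝ) (f : G → Fin (d + 1) → A) : Prop :=
  ∀ g h : G, ∀ j k : Fin (d + 1), ∀ a ∈ F, ‖(f g j * f h k - f h k * f g j) * a‖ < ε

/-- `α` has Rokhlin dimension at most `d`. -/
def HasRokhlinDimLE (α : CStarPartialAction G A) (d : ℕ) : Prop :=
  ∀ ε > (0 : ℝ), ∀ F : Finset A, ∃ f : G → Fin (d + 1) → A, RokhlinTowers α d F ε f

/-- `α` has Rokhlin dimension with commuting towers at most `d`. -/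
def HasRokhlinDimCLE (α : CStarPartialAction G A) (d : ℕ) : Prop :=
  ∀ ε > (0 : ℝ), ∀ F : Finset A, ∃ f : G → Fin (d + 1) → A,
    RokhlinTowers α d F ε f ∧ CommutingTowers d F ε f

/-- The Rokhlin dimension of `α`, as an extended natural number. -/
noncomputable def rokhlinDim (α : CStarPartialAction G A) : ℕ∞ :=
  sInf {n : ℕ∞ | ∃ d : ℕ, n = d ∧ HasRokhlinDimLE α d}

/-- The Rokhlin dimension with commuting towers of `α`. -/
noncomputable def rokhlinDimC (α : CStarPartialAction G A) : ℕ∞ :=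
  sInf {n : ℕ∞ | ∃ d : ℕ, n = d ∧ HasRokhlinDimCLE α d}

section UnitalPartialAction

variable {G : Type*} [Group G] {A : Type*} [CStarAlgebra A] {α : CStarPartialAction G A} {e : G → A}

/-- The unit of an ideal is central in the whole algebra. -/
theorem CStarPartialAction.unit_mul_comm (he : ∀ g, e g ∈ α.dom g)
    (hunit : ∀ g, ∀ x ∈ α.dom g, e g * x = x ∧ x * e g = x) (g : G) (x : A) :
    e g * x = x * e g := by
  rw [← (hunit g _ (α.mul_mem_right g x _ (he g))).2, mul_assoc,
    (hunit g _ (α.mul_mem_left g x _ (he g))).1]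

theorem CStarPartialAction.unit_star (he : ∀ g, e g ∈ α.dom g)
    (hunit : ∀ g, ∀ x ∈ α.dom g, e g * x = x ∧ x * e g = x) (g : G) :
    star (e g) = e g := by
  have h := (hunit g _ (α.star_mem g _ (he g))).1
  have h' := congrArg star h
  rw [star_mul, star_star, h] at h'
  exact h'

theorem CStarPartialAction.unit_one (hunit : ∀ g, ∀ x ∈ α.dom g, e g * x = x ∧ x * e g = x) :
    e 1 = 1 := by
  have h := (hunit 1 1 (by rw [α.dom_one]; trivial)).1
  rwa [mul_one] at h

/-- A partial automorphism carries the unit of an intersection of ideals to the unit of its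
image. -/
theorem CStarPartialAction.act_unit_mul_unit (he : ∀ g, e g ∈ α.dom g)
    (hunit : ∀ g, ∀ x ∈ α.dom g, e g * x = x ∧ x * e g = x) (g h : G) :
    α.act g (e g⁻¹ * e h) = e g * e (g * h) := by
  have hu : e g⁻¹ * e h ∈ α.dom g⁻¹ ∩ α.dom h :=
    ⟨α.mul_mem_right _ _ _ (he _), α.mul_mem_left _ _ _ (he _)⟩
  have hw : e g * e (g * h) ∈ α.dom g⁻¹⁻¹ ∩ α.dom (g * h) :=
    ⟨by rw [inv_inv]; exact α.mul_mem_right _ _ _ (he _), α.mul_mem_left _ _ _ (he _)⟩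
  have hv := α.act_inter_mem g⁻¹ (g * h) _ hw
  rw [inv_mul_cancel_left] at hv
  have hvw := α.act_inv_act g⁻¹ _ hw.1
  rw [inv_inv] at hvw
  have hau := α.act_inter_mem g h _ hu
  have h₁ : α.act g⁻¹ (e g * e (g * h)) * (e g⁻¹ * e h) = α.act g⁻¹ (e g * e (g * h)) := by
    rw [← mul_assoc, (hunit _ _ hv.1).2, (hunit _ _ hv.2).2]
  have h₂ := α.act_mul g _ hv.1 _ hu.1
  rw [h₁, hvw, mul_assoc, (hunit _ _ hau.2).1, (hunit _ _ hau.1).1] at h₂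
  exact h₂.symm

theorem CStarPartialAction.act_unit (he : ∀ g, e g ∈ α.dom g)
    (hunit : ∀ g, ∀ x ∈ α.dom g, e g * x = x ∧ x * e g = x) (g : G) :
    α.act g (e g⁻¹) = e g := by
  have h := α.act_unit_mul_unit he hunit g g⁻¹
  rwa [mul_inv_cancel, α.unit_one hunit, mul_one, (hunit _ _ (he _)).1] at h

/-- The globally defined *-homomorphism `x ↦ α_g (x * 1_{g⁻¹})` attached to a unital partial
action. -/
def CStarPartialAction.cutHom (α : CStarPartialAction G A) (he : ∀ g, e g ∈ α.dom g)
    (hunit : ∀ g, ∀ x ∈ α.dom g, e g * x = x ∧ x * e g = x) (g : G) : A →⋆ₙₐ[ℂ] A where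
  toFun x := α.act g (x * e g⁻¹)
  map_smul' c x := by
    rw [smul_mul_assoc, α.act_smul _ _ _ (α.mul_mem_left _ _ _ (he _))]
    rfl
  map_zero' := by
    have h := α.act_smul g 0 0 (α.zero_mem _)
    rw [zero_smul, zero_smul] at h
    rw [zero_mul, h]
  map_add' x y := by
    rw [add_mul, α.act_add _ _ (α.mul_mem_left _ _ _ (he _)) _ (α.mul_mem_left _ _ _ (he _))]
  map_mul' x y := by
    rw [← α.act_mul _ _ (α.mul_mem_left _ _ _ (he _)) _ (α.mul_mem_left _ _ _ (he _)),
      mul_assoc x (e g⁻¹), (hunit _ _ (α.mul_mem_left _ y _ (he _))).1, mul_assoc]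
  map_star' x := by
    rw [← α.act_star _ _ (α.mul_mem_left _ _ _ (he _)), star_mul, α.unit_star he hunit,
      α.unit_mul_comm he hunit]

theorem CStarPartialAction.cutHom_apply (he : ∀ g, e g ∈ α.dom g)
    (hunit : ∀ g, ∀ x ∈ α.dom g, e g * x = x ∧ x * e g = x) (g : G) (x : A) :
    α.cutHom he hunit g x = α.act g (x * e g⁻¹) := rfl

theorem CStarPartialAction.cutHom_mem (he : ∀ g, e g ∈ α.dom g)
    (hunit : ∀ g, ∀ x ∈ α.dom g, e g * x = x ∧ x * e g = x) (g : G) (x : A) :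
    α.cutHom he hunit g x ∈ α.dom g :=
  α.act_mem _ _ (α.mul_mem_left _ _ _ (he _))

theorem CStarPartialAction.cutHom_cutHom (he : ∀ g, e g ∈ α.dom g)
    (hunit : ∀ g, ∀ x ∈ α.dom g, e g * x = x ∧ x * e g = x) (g h : G) (x : A) :
    α.cutHom he hunit g (α.cutHom he hunit h x) = α.cutHom he hunit (g * h) x * e g := by
  have hm : ∀ k y, y * e k ∈ α.dom k := fun k y => α.mul_mem_left _ _ _ (he _)
  have h₁ : α.act h (x * e h⁻¹) * e g⁻¹ = α.act h (x * e h⁻¹ * e (g * h)⁻¹) := by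
    have hl := α.act_unit_mul_unit he hunit h (g * h)⁻¹
    rw [mul_inv_rev, mul_inv_cancel_left] at hl
    have hr := α.act_mul h _ (hm h⁻¹ x) _ (α.mul_mem_right _ (e (h⁻¹ * g⁻¹)) _ (he h⁻¹))
    rw [hl, ← mul_assoc, ← mul_assoc, (hunit _ _ (hm h⁻¹ x)).2,
      (hunit _ _ (α.act_mem h _ (hm h⁻¹ x))).2] at hr
    rw [mul_inv_rev, hr]
  have h₂ : α.act (g * h) (x * e (g * h)⁻¹) * e g
      = α.act (g * h) (x * e h⁻¹ * e (g * h)⁻¹) := by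
    have hl := α.act_unit_mul_unit he hunit (g * h) h⁻¹
    rw [mul_inv_cancel_right] at hl
    have hr := α.act_mul (g * h) _ (hm (g * h)⁻¹ x) _
      (α.mul_mem_right _ (e h⁻¹) _ (he (g * h)⁻¹))
    rw [hl, ← mul_assoc, ← mul_assoc, (hunit _ _ (hm _ x)).2,
      (hunit _ _ (α.act_mem (g * h) _ (hm _ x))).2] at hr
    rw [← hr, mul_assoc x, α.unit_mul_comm he hunit, ← mul_assoc]
  rw [cutHom_apply, cutHom_apply, cutHom_apply, h₁, h₂, α.act_comp g h]
  exact ⟨α.mul_mem_right _ _ _ (hm _ _), hm _ _⟩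

theorem IsPosContraction.map {B : Type*} [CStarAlgebra B] (φ : A →⋆ₙₐ[ℂ] B) {f : A}
    (hf : IsPosContraction f) : IsPosContraction (φ f) := by
  obtain ⟨⟨b, rfl⟩, hn⟩ := hf
  exact ⟨⟨φ b, by rw [map_mul, map_star]⟩, (NonUnitalStarAlgHom.norm_apply_le φ _).trans hn⟩

/-- Exact equivariance implies approximate equivariance with error zero. -/
theorem CStarPartialAction.act_mul_eq_of_exact (he : ∀ g, e g ∈ α.dom g)
    (hunit : ∀ g, ∀ x ∈ α.dom g, e g * x = x ∧ x * e g = x) {g : G} {p q x : A}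
    (h : α.act g (p * e g⁻¹) = q * e g) (hx : x ∈ α.dom g⁻¹) :
    α.act g (p * x) = q * α.act g x := by
  have h₁ := α.act_mul g _ (α.mul_mem_left _ p _ (he g⁻¹)) _ hx
  rwa [h, mul_assoc, (hunit _ _ hx).1, mul_assoc, (hunit _ _ (α.act_mem g x hx)).1] at h₁

theorem norm_mul_mul_le_of_norm_sub_le {p p' q q' : A} {δ : ℝ} (hq : ‖q‖ ≤ 1) (hp' : ‖p'‖ ≤ 1)
    (h₁ : ‖p' - p‖ ≤ δ) (h₂ : ‖q' - q‖ ≤ δ) (a : A) :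
    ‖p' * q' * a - p * q * a‖ ≤ 2 * δ * ‖a‖ := by
  have h : p' * q' * a - p * q * a = (p' * (q' - q) + (p' - p) * q) * a := by noncomm_ring
  rw [h]
  refine (norm_mul_le _ _).trans (mul_le_mul_of_nonneg_right ?_ (norm_nonneg a))
  have h₃ : ‖p' * (q' - q)‖ ≤ 1 * δ :=
    (norm_mul_le _ _).trans (mul_le_mul hp' h₂ (norm_nonneg _) zero_le_one)
  have h₄ : ‖(p' - p) * q‖ ≤ δ * 1 :=
    (norm_mul_le _ _).trans (mul_le_mul h₁ hq (norm_nonneg _) ((norm_nonneg _).trans h₁))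
  linarith [norm_add_le (p' * (q' - q)) ((p' - p) * q)]

theorem norm_commutator_mul_le_of_norm_sub_le {p p' : A} {δ : ℝ} (h₁ : ‖p' - p‖ ≤ δ) (a b : A) :
    ‖(p' * b - b * p') * a - (p * b - b * p) * a‖ ≤ 2 * δ * ‖b‖ * ‖a‖ := by
  have h : (p' * b - b * p') * a - (p * b - b * p) * a
      = ((p' - p) * b - b * (p' - p)) * a := by noncomm_ring
  rw [h]
  refine (norm_mul_le _ _).trans (mul_le_mul_of_nonneg_right ?_ (norm_nonneg a))
  have h₃ : ‖(p' - p) * b‖ ≤ δ * ‖b‖ :=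
    (norm_mul_le _ _).trans (mul_le_mul_of_nonneg_right h₁ (norm_nonneg _))
  have h₄ : ‖b * (p' - p)‖ ≤ ‖b‖ * δ :=
    (norm_mul_le _ _).trans (mul_le_mul_of_nonneg_left h₁ (norm_nonneg _))
  linarith [norm_sub_le ((p' - p) * b) (b * (p' - p))]

variable [Fintype G]

/-- Rokhlin towers for a large finite set are close to exactly equivariant ones. -/
theorem RokhlinTowers.exists_exact (he : ∀ g, e g ∈ α.dom g)
    (hunit : ∀ g, ∀ x ∈ α.dom g, e g * x = x ∧ x * e g = x) {d : ℕ} {F : Finset A} {δ : ℝ}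
    {f : G → Fin (d + 1) → A} (hf : RokhlinTowers α d F δ f) (h_one : (1 : A) ∈ F)
    (h_unit : ∀ g, e g ∈ F) :
    ∃ f' : G → Fin (d + 1) → A, (∀ g j, f' g j ∈ α.dom g ∧ IsPosContraction (f' g j)) ∧
      (∀ g h : G, ∀ j, α.act g (f' h j * e g⁻¹) = f' (g * h) j * e g) ∧
      ∀ g j, ‖f' g j - f g j‖ ≤ δ := by
  refine ⟨fun g j => α.cutHom he hunit g (f 1 j),
    fun g j => ⟨α.cutHom_mem he hunit _ _, (hf.1 1 j).2.map _⟩,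
    fun g h j => α.cutHom_cutHom he hunit g h _, fun g j => ?_⟩
  have h := hf.2.1 g 1 j 1 h_one _ (h_unit g⁻¹) (he _)
  rw [mul_one, mul_one, α.act_unit he hunit, (hunit _ _ (hf.1 g j).1).2] at h
  exact h.le

/-- Conditions (2)–(4) survive a small perturbation of the towers, and so does (5). -/
theorem RokhlinTowers.of_norm_sub_le {d : ℕ} {F F' : Finset A} (hF : F ⊆ F') {δ ε M : ℝ}
    (hδ : 0 ≤ δ) (hM : 1 ≤ M) (hFM : ∀ a ∈ F, ‖a‖ ≤ M)
    (hε : δ + ((d + 1) * Fintype.card G + 4) * δ * (M * M) ≤ ε)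
    {f f' : G → Fin (d + 1) → A} (hf : RokhlinTowers α d F' δ f)
    (hf' : ∀ g j, ‖f' g j‖ ≤ 1) (hff' : ∀ g j, ‖f' g j - f g j‖ ≤ δ) :
    (∀ j, ∀ g h : G, g ≠ h → ∀ a ∈ F, ‖f' g j * f' h j * a‖ < ε) ∧
    (∀ a ∈ F, ‖(∑ j : Fin (d + 1), ∑ g : G, f' g j) * a - a‖ < ε) ∧
    (∀ g j, ∀ a ∈ F, ∀ b ∈ F, ‖(f' g j * b - b * f' g j) * a‖ < ε) ∧
    (CommutingTowers d F' δ f → CommutingTowers d F ε f') := by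
  have hN : (0 : ℝ) ≤ (d + 1) * Fintype.card G := by positivity
  have hMM : M ≤ M * M := by nlinarith
  have hδM : 0 ≤ δ * (M * M) := by positivity
  have hNδM : 0 ≤ (d + 1) * Fintype.card G * (δ * (M * M)) := by positivity
  have ha : ∀ a ∈ F, δ * ‖a‖ ≤ δ * (M * M) := fun a h =>
    mul_le_mul_of_nonneg_left ((hFM a h).trans hMM) hδ
  refine ⟨fun j g h hgh a haF => ?_, fun a haF => ?_, fun g j a haF b hbF => ?_,
    fun hc g h j k a haF => ?_⟩
  · have h₁ := hf.2.2.1 j g h hgh a (hF haF)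
    have h₂ := norm_mul_mul_le_of_norm_sub_le (hf.1 h j).2.2 (hf' g j) (hff' g j) (hff' h j) a
    have h₃ := norm_le_norm_add_norm_sub' (f' g j * f' h j * a) (f g j * f h j * a)
    linarith [ha a haF]
  · have h₁ := hf.2.2.2.1 a (hF haF)
    have h₂ : ‖∑ j : Fin (d + 1), ∑ g : G, f' g j - ∑ j : Fin (d + 1), ∑ g : G, f g j‖
        ≤ (d + 1) * Fintype.card G * δ := by
      rw [← Finset.sum_sub_distrib]
      refine (norm_sum_le_of_le _ (n := fun _ => Fintype.card G * δ) fun j _ => ?_).trans ?_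
      · rw [← Finset.sum_sub_distrib]
        refine (norm_sum_le_of_le _ fun g _ => hff' g j).trans ?_
        simp
      · simp [mul_assoc]
    have h₃ := (norm_mul_le _ a).trans (mul_le_mul_of_nonneg_right h₂ (norm_nonneg a))
    have h₄ := norm_le_norm_add_norm_sub' ((∑ j : Fin (d + 1), ∑ g : G, f' g j) * a - a)
      ((∑ j : Fin (d + 1), ∑ g : G, f g j) * a - a)
    rw [sub_sub_sub_cancel_right, ← sub_mul] at h₄
    have h₅ := mul_le_mul_of_nonneg_left (ha a haF) hN
    linarith
  · have h₁ := hf.2.2.2.2 g j a (hF haF) b (hF hbF)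
    have h₂ := norm_commutator_mul_le_of_norm_sub_le (hff' g j) a b
    have h₃ := norm_le_norm_add_norm_sub' ((f' g j * b - b * f' g j) * a)
      ((f g j * b - b * f g j) * a)
    have h₄ : δ * (‖b‖ * ‖a‖) ≤ δ * (M * M) := mul_le_mul_of_nonneg_left
      (mul_le_mul (hFM b hbF) (hFM a haF) (norm_nonneg _) (zero_le_one.trans hM)) hδ
    linarith
  · have h₁ := hc g h j k a (hF haF)
    have h₂ := norm_mul_mul_le_of_norm_sub_le (hf.1 h k).2.2 (hf' g j) (hff' g j) (hff' h k) a
    have h₃ := norm_mul_mul_le_of_norm_sub_le (hf.1 g j).2.2 (hf' h k) (hff' h k) (hff' g j) a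
    have h₄ := norm_le_norm_add_norm_sub' ((f' g j * f' h k - f' h k * f' g j) * a)
      ((f g j * f h k - f h k * f g j) * a)
    have h₅ : (f' g j * f' h k - f' h k * f' g j) * a - (f g j * f h k - f h k * f g j) * a
        = (f' g j * f' h k * a - f g j * f h k * a)
          - (f' h k * f' g j * a - f h k * f g j * a) := by noncomm_ring
    rw [h₅] at h₄
    have h₆ := norm_sub_le (f' g j * f' h k * a - f g j * f h k * a)
      (f' h k * f' g j * a - f h k * f g j * a)
    linarith [ha a haF]

theorem RokhlinTowers.of_exact (he : ∀ g, e g ∈ α.dom g)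
    (hunit : ∀ g, ∀ x ∈ α.dom g, e g * x = x ∧ x * e g = x) {d : ℕ} {F : Finset A} {ε : ℝ}
    (hε : 0 < ε) {f : G → Fin (d + 1) → A}
    (h₀ : ∀ g j, f g j ∈ α.dom g ∧ IsPosContraction (f g j))
    (h₁ : ∀ g h : G, ∀ j, α.act g (f h j * e g⁻¹) = f (g * h) j * e g)
    (h₂ : ∀ j, ∀ g h : G, g ≠ h → ∀ a ∈ F, ‖f g j * f h j * a‖ < ε)
    (h₃ : ∀ a ∈ F, ‖(∑ j : Fin (d + 1), ∑ g : G, f g j) * a - a‖ < ε)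
    (h₄ : ∀ g j, ∀ a ∈ F, ∀ b ∈ F, ‖(f g j * b - b * f g j) * a‖ < ε) :
    RokhlinTowers α d F ε f := by
  refine ⟨h₀, fun g h j a _ x _ hx => ?_, h₂, h₃, h₄⟩
  rwa [α.act_mul_eq_of_exact he hunit (h₁ g h j) hx, sub_self, zero_mul, norm_zero]

open Classical in
/-- Exactly equivariant towers for `(F, ε)` can be extracted from Rokhlin towers for a larger
finite set and a smaller tolerance. -/
theorem exists_finset_tolerance_exact (he : ∀ g, e g ∈ α.dom g)
    (hunit : ∀ g, ∀ x ∈ α.dom g, e g * x = x ∧ x * e g = x) (d : ℕ) {ε : ℝ} (hε : 0 < ε)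
    (F : Finset A) :
    ∃ δ > (0 : ℝ), ∃ F' : Finset A, ∀ f : G → Fin (d + 1) → A, RokhlinTowers α d F' δ f →
      ∃ f' : G → Fin (d + 1) → A,
        (∀ g j, f' g j ∈ α.dom g ∧ IsPosContraction (f' g j)) ∧
        (∀ g h : G, ∀ j, α.act g (f' h j * e g⁻¹) = f' (g * h) j * e g) ∧
        (∀ j, ∀ g h : G, g ≠ h → ∀ a ∈ F, ‖f' g j * f' h j * a‖ < ε) ∧
        (∀ a ∈ F, ‖(∑ j : Fin (d + 1), ∑ g : G, f' g j) * a - a‖ < ε) ∧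
        (∀ g j, ∀ a ∈ F, ∀ b ∈ F, ‖(f' g j * b - b * f' g j) * a‖ < ε) ∧
        (CommutingTowers d F' δ f → CommutingTowers d F ε f') := by
  have hM : (1 : ℝ) ≤ 1 + ∑ a ∈ F, ‖a‖ :=
    le_add_of_nonneg_right (Finset.sum_nonneg fun _ _ => norm_nonneg _)
  have hFM : ∀ a ∈ F, ‖a‖ ≤ 1 + ∑ a ∈ F, ‖a‖ := fun a ha =>
    (Finset.single_le_sum (f := fun a : A => ‖a‖) (fun _ _ => norm_nonneg _) ha).trans
      (le_add_of_nonneg_left zero_le_one)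
  set M : ℝ := 1 + ∑ a ∈ F, ‖a‖
  set K : ℝ := 1 + ((d + 1) * Fintype.card G + 4) * (M * M) with hK
  have hK0 : 0 < K := by positivity
  have hKε : ε / K + ((d + 1) * Fintype.card G + 4) * (ε / K) * (M * M) ≤ ε := by
    apply le_of_eq
    calc _ = ε / K * K := by rw [hK]; ring
      _ = ε := div_mul_cancel₀ _ hK0.ne'
  refine ⟨ε / K, div_pos hε hK0, F ∪ insert 1 (Finset.univ.image e), fun f hf => ?_⟩
  obtain ⟨f', h₀, h₁, h₂⟩ := hf.exists_exact he hunit (by simp) (by simp)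
  exact ⟨f', h₀, h₁, hf.of_norm_sub_le Finset.subset_union_left (div_pos hε hK0).le hM hFM hKε
    (fun g j => (h₀ g j).2.2) h₂⟩

end UnitalPartialAction

/-- For a unital partial action `α` of a finite group `G` on a C*-algebra `A`
(with units `e g` for the ideals `α.dom g`), `dim_Rok(α) ≤ d` iff for every `ε > 0` and finite
`F ⊆ A` there are Rokhlin towers satisfying the *exact* equivariance condition
(1') `α_g (f_h^{(j)} * 1_{g⁻¹}) = f_{gh}^{(j)} * 1_g` together with conditions (2)–(4);
analogously for `dim_Rok^c ≤ d` with condition (5) added. -/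
theorem hasRokhlinDimLE_iff_exact_equivariance {G : Type*} [Group G] [Fintype G]
    {A : Type*} [CStarAlgebra A] (α : CStarPartialAction G A) (e : G → A)
    (he : ∀ g, e g ∈ α.dom g)
    (hunit : ∀ g, ∀ x ∈ α.dom g, e g * x = x ∧ x * e g = x) (d : ℕ) :
    (HasRokhlinDimLE α d ↔
      ∀ ε > (0 : ℝ), ∀ F : Finset A, ∃ f : G → Fin (d + 1) → A,
        (∀ g j, f g j ∈ α.dom g ∧ IsPosContraction (f g j)) ∧
        (∀ g h : G, ∀ j, α.act g (f h j * e g⁻¹) = f (g * h) j * e g) ∧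
        (∀ j, ∀ g h : G, g ≠ h → ∀ a ∈ F, ‖f g j * f h j * a‖ < ε) ∧
        (∀ a ∈ F, ‖(∑ j : Fin (d + 1), ∑ g : G, f g j) * a - a‖ < ε) ∧
        (∀ g j, ∀ a ∈ F, ∀ b ∈ F, ‖(f g j * b - b * f g j) * a‖ < ε)) ∧
    (HasRokhlinDimCLE α d ↔
      ∀ ε > (0 : ℝ), ∀ F : Finset A, ∃ f : G → Fin (d + 1) → A,
        (∀ g j, f g j ∈ α.dom g ∧ IsPosContraction (f g j)) ∧
        (∀ g h : G, ∀ j, α.act g (f h j * e g⁻¹) = f (g * h) j * e g) ∧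
        (∀ j, ∀ g h : G, g ≠ h → ∀ a ∈ F, ‖f g j * f h j * a‖ < ε) ∧
        (∀ a ∈ F, ‖(∑ j : Fin (d + 1), ∑ g : G, f g j) * a - a‖ < ε) ∧
        (∀ g j, ∀ a ∈ F, ∀ b ∈ F, ‖(f g j * b - b * f g j) * a‖ < ε) ∧
        CommutingTowers d F ε f) := by
  refine ⟨⟨fun H ε hε F => ?_, fun H ε hε F => ?_⟩, ⟨fun H ε hε F => ?_, fun H ε hε F => ?_⟩⟩
  · obtain ⟨δ, hδ, F', h⟩ := exists_finset_tolerance_exact he hunit d hε F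
    obtain ⟨f, hf⟩ := H δ hδ F'
    obtain ⟨f', h₀, h₁, h₂, h₃, h₄, -⟩ := h f hf
    exact ⟨f', h₀, h₁, h₂, h₃, h₄⟩
  · obtain ⟨f, h₀, h₁, h₂, h₃, h₄⟩ := H ε hε F
    exact ⟨f, RokhlinTowers.of_exact he hunit hε h₀ h₁ h₂ h₃ h₄⟩
  · obtain ⟨δ, hδ, F', h⟩ := exists_finset_tolerance_exact he hunit d hε F
    obtain ⟨f, hf, hc⟩ := H δ hδ F'
    obtain ⟨f', h₀, h₁, h₂, h₃, h₄, h₅⟩ := h f hf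
    exact ⟨f', h₀, h₁, h₂, h₃, h₄, h₅ hc⟩
  · obtain ⟨f, h₀, h₁, h₂, h₃, h₄, h₅⟩ := H ε hε F
    exact ⟨f, RokhlinTowers.of_exact he hunit hε h₀ h₁ h₂ h₃ h₄, h₅⟩
end

section
/- Let G be a finite group, let B be a unital C*-algebra, let β : G → Aut(B) be an action of G on B by *-automorphisms, and let A ⊆ B be a closed two-sided ideal possessing a unit 1_A, such that B = Σ_{g∈G} β_g(A). Then there exist projections p_g ∈ A (g ∈ G), each central in B, such that the projections β_g(p_g) (g ∈ G) are pairwise orthogonal and Σ_{g∈G} β_g(p_g) = 1_B. -/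
/-- A (global) action of a group `G` on a C*-algebra `B` by *-automorphisms:
`act g` is additive, `ℂ`-linear, multiplicative and star-preserving, `act 1 = id` and
`act (g*h) = act g ∘ act h` (hence each `act g` is a *-automorphism). -/
structure CStarGlobalAction (G : Type*) [Group G] (B : Type*) [NonUnitalCStarAlgebra B] where
  act : G → B → B
  act_one : ∀ x, act 1 x = x
  act_comp : ∀ g h x, act (g * h) x = act g (act h x)
  map_add : ∀ g x y, act g (x + y) = act g x + act g y
  map_smul : ∀ g (c : ℂ) x, act g (c • x) = c • act g x
  map_mul : ∀ g x y, act g (x * y) = act g x * act g y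
  map_star : ∀ g x, act g (star x) = star (act g x)

/-- Finitely many idempotents of a commutative ring, indexed by a linear order, can be made
pairwise orthogonal without changing the idempotent they generate. -/
theorem exists_orthogonal_idempotents_sum_eq {R ι : Type*} [CommRing R] [Fintype ι]
    (e : ι → R) (he : ∀ i, IsIdempotentElem (e i)) :
    ∃ q : ι → R, (∀ i, e i ∣ q i) ∧ (∀ i, IsIdempotentElem (q i)) ∧
      (∀ i j, i ≠ j → q i * q j = 0) ∧ ∑ i, q i = 1 - ∏ i, (1 - e i) := by
  classical
  let _ : LinearOrder ι := LinearOrder.lift' (Fintype.equivFin ι) (Fintype.equivFin ι).injective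
  have orthogonal_of_lt : ∀ i j, i < j →
      (e i * ∏ k with k < i, (1 - e k)) * (e j * ∏ k with k < j, (1 - e k)) = 0 := by
    intro i j hij
    obtain ⟨c, hc⟩ : (1 - e i) ∣ ∏ k with k < j, (1 - e k) :=
      Finset.dvd_prod_of_mem (fun k => 1 - e k) (by simpa using hij)
    rw [hc]
    linear_combination (-(∏ k with k < i, (1 - e k)) * e j * c) * (he i).eq
  refine ⟨fun i => e i * ∏ k with k < i, (1 - e k), fun i => dvd_mul_right _ _, fun i => ?_,
    fun i j hij => ?_, ?_⟩
  · refine (he i).mul ?_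
    rw [IsIdempotentElem, ← Finset.prod_mul_distrib]
    exact Finset.prod_congr rfl fun k _ => (he k).one_sub.eq
  · rcases lt_or_gt_of_ne hij with h | h
    · exact orthogonal_of_lt i j h
    · rw [mul_comm]
      exact orthogonal_of_lt j i h
  · rw [Finset.prod_one_sub_ordered, sub_sub_cancel]

/-- A central idempotent of a C*-algebra is self-adjoint. -/
theorem IsIdempotentElem.isSelfAdjoint_of_central {B : Type*} [CStarAlgebra B] {e : B}
    (he : IsIdempotentElem e) (hc : ∀ b, e * b = b * e) : IsSelfAdjoint e :=
  (isStarProjection_iff_isIdempotentElem_and_isStarNormal.mpr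
    ⟨he, ⟨(hc _).symm⟩⟩).isSelfAdjoint

namespace CStarGlobalAction

variable {G : Type*} [Group G] {B : Type*} [CStarAlgebra B] (β : CStarGlobalAction G B)

theorem act_act_inv (g : G) (x : B) : β.act g (β.act g⁻¹ x) = x := by
  rw [← β.act_comp, mul_inv_cancel, β.act_one]

theorem act_inv_act (g : G) (x : B) : β.act g⁻¹ (β.act g x) = x := by
  rw [← β.act_comp, inv_mul_cancel, β.act_one]

theorem act_idempotent (g : G) {x : B} (hx : IsIdempotentElem x) :
    IsIdempotentElem (β.act g x) := by
  rw [IsIdempotentElem, ← β.map_mul, hx.eq]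

theorem act_central (g : G) {x : B} (hx : ∀ b, x * b = b * x) (b : B) :
    β.act g x * b = b * β.act g x := by
  rw [← β.act_act_inv g b, ← β.map_mul, ← β.map_mul, hx]

end CStarGlobalAction

/-- If `β` is a global action of a finite group `G` on a unital C*-algebra
`B` and `I ⊆ B` is a closed two-sided ideal with a unit `eI`, such that
`B = Σ_{g ∈ G} β_g(I)`, then there exist projections `p g ∈ I`, central in `B`, with the
`β g (p g)` pairwise orthogonal and `∑ g, β g (p g) = 1`. -/
theorem exists_central_projections_partition_of_unit
    {G : Type*} [Group G] [Fintype G] {B : Type*} [CStarAlgebra B]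
    (β : CStarGlobalAction G B) (I : Set B)
    (hIclosed : IsClosed I) (hI0 : (0 : B) ∈ I)
    (hIadd : ∀ x ∈ I, ∀ y ∈ I, x + y ∈ I)
    (hIsmul : ∀ (c : ℂ), ∀ x ∈ I, c • x ∈ I)
    (hImull : ∀ (b : B), ∀ x ∈ I, b * x ∈ I)
    (hImulr : ∀ (b : B), ∀ x ∈ I, x * b ∈ I)
    (eI : B) (heI : eI ∈ I) (hunit : ∀ x ∈ I, eI * x = x ∧ x * eI = x)
    (hspan : ∀ b : B, b ∈ Submodule.span ℂ (⋃ g : G, β.act g '' I)) :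
    ∃ p : G → B,
      (∀ g, p g ∈ I) ∧
      (∀ g, IsSelfAdjoint (p g) ∧ IsIdempotentElem (p g)) ∧
      (∀ g, ∀ b : B, p g * b = b * p g) ∧
      (∀ g h, g ≠ h → β.act g (p g) * β.act h (p h) = 0) ∧
      (∑ g : G, β.act g (p g) = 1) := by
  have e_idem : IsIdempotentElem eI := (hunit eI heI).1
  have e_central : ∀ b, eI * b = b * eI := fun b =>
    ((hunit _ (hImulr b eI heI)).2.symm.trans (mul_assoc _ _ _)).trans
      (hunit _ (hImull b eI heI)).1
  let e : G → Subring.center B := fun g =>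
    ⟨β.act g eI, Subring.mem_center_iff.mpr fun b => (β.act_central g e_central b).symm⟩
  have e_idem' : ∀ g, IsIdempotentElem (e g) := fun g =>
    Subtype.ext (β.act_idempotent g e_idem)
  obtain ⟨q, q_dvd, q_idem, q_orth, q_sum⟩ := exists_orthogonal_idempotents_sum_eq e e_idem'
  have prod_annihilates : ∀ b : B, ((∏ g, (1 - e g) : Subring.center B) : B) * b = 0 := by
    intro b
    induction hspan b using Submodule.span_induction with
    | mem x hx =>
      obtain ⟨g, y, hy, rfl⟩ := Set.mem_iUnion.mp hx
      obtain ⟨c, hc⟩ : (1 - e g) ∣ ∏ g, (1 - e g) :=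
        Finset.dvd_prod_of_mem (fun g => 1 - e g) (Finset.mem_univ g)
      have fixes : (e g : B) * β.act g y = β.act g y := by
        rw [← β.map_mul, (hunit y hy).1]
      rw [hc, mul_comm, Subring.coe_mul, mul_assoc, AddSubgroupClass.coe_sub, Subring.coe_one,
        sub_mul, one_mul, fixes, sub_self, mul_zero]
    | zero => exact mul_zero _
    | add x y _ _ hx hy => rw [mul_add, hx, hy, add_zero]
    | smul c x _ hx => rw [mul_smul_comm, hx, smul_zero]
  have prod_eq_zero : ∏ g, (1 - e g) = 0 :=
    Subtype.ext (by simpa using prod_annihilates 1)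
  have q_central : ∀ g b, (q g : B) * b = b * q g := fun g b =>
    (Subring.mem_center_iff.mp (q g).2 b).symm
  have p_idem : ∀ g, IsIdempotentElem (β.act g⁻¹ (q g : B)) := fun g =>
    β.act_idempotent g⁻¹ (congrArg Subtype.val (q_idem g))
  have p_central : ∀ g b, β.act g⁻¹ (q g : B) * b = b * β.act g⁻¹ (q g : B) := fun g =>
    β.act_central g⁻¹ (q_central g)
  refine ⟨fun g => β.act g⁻¹ (q g), fun g => ?_,
    fun g => ⟨(p_idem g).isSelfAdjoint_of_central (p_central g), p_idem g⟩, p_central,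
    fun g h hgh => ?_, ?_⟩
  · obtain ⟨c, hc⟩ := q_dvd g
    have hmul : β.act g⁻¹ (q g : B) = eI * β.act g⁻¹ c := by
      rw [hc, Subring.coe_mul, β.map_mul, β.act_inv_act]
    simpa only [hmul] using hImulr _ eI heI
  · simpa only [β.act_act_inv, Subring.coe_mul, Subring.coe_zero] using
      congrArg Subtype.val (q_orth g h hgh)
  · rw [prod_eq_zero, sub_zero] at q_sum
    simpa [β.act_act_inv] using congrArg Subtype.val q_sum
end

section
/- Let β : G → Aut(B) be an action of a finite group G on a unital C*-algebra B with dim_Rok(β) = d < ∞, and let A be a closed two-sided ideal of B possessing a unit, such that B is the closed linear span of {β_g(a) : a ∈ A, g ∈ G}. Then for every ε > 0 and every finite subset F ⊆ B there exist positive contractions f_g^(j) ∈ B (g ∈ G, j = 0,…,d) with f_1^(j) ∈ A for all j, satisfying: (a) β_g(f_h^(j)) = f_{gh}^(j) for all g, h ∈ G and all j; (b) ‖f_g^(j) f_h^(j)‖ < ε for all j and all g ≠ h in G; (c) ‖1_B − Σ_{g∈G} Σ_{j=0}^d f_g^(j)‖ ≤ ε; (d) ‖f_g^(j) b − b f_g^(j)‖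 < ε for all g, j and all b ∈ F. If moreover dim_Rok^c(β) = d, the towers can additionally be chosen so that ‖f_g^(j) f_h^(k) − f_h^(k) f_g^(j)‖ < ε for all g, h ∈ G and j, k = 0,…,d. -/
variable {G : Type*} [Group G] [Fintype G] {B : Type*} [CStarAlgebra B]

/-- Rokhlin towers for a global action of a finite group on a unital C*-algebra. -/
def GlobalRokhlinTowers (β : CStarGlobalAction G B) (d : ℕ) (F : Finset B) (ε : ℝ)
    (f : G → Fin (d + 1) → B) : Prop :=
  (∀ g j, IsPosContraction (f g j)) ∧
  (∀ g h : G, ∀ j, ‖β.act g (f h j) - f (g * h) j‖ < ε) ∧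
  (∀ j, ∀ g h : G, g ≠ h → ‖f g j * f h j‖ < ε) ∧
  (‖(∑ j : Fin (d + 1), ∑ g : G, f g j) - 1‖ < ε) ∧
  (∀ g j, ∀ b ∈ F, ‖f g j * b - b * f g j‖ < ε)

/-- `dim_Rok(β) ≤ d` for a global action `β`. -/
def HasGlobalRokhlinDimLE (β : CStarGlobalAction G B) (d : ℕ) : Prop :=
  ∀ ε > (0 : ℝ), ∀ F : Finset B, ∃ f : G → Fin (d + 1) → B, GlobalRokhlinTowers β d F ε f

/-- `dim_Rok^c(β) ≤ d` for a global action `β`. -/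
def HasGlobalRokhlinDimCLE (β : CStarGlobalAction G B) (d : ℕ) : Prop :=
  ∀ ε > (0 : ℝ), ∀ F : Finset B, ∃ f : G → Fin (d + 1) → B, GlobalRokhlinTowers β d F ε f ∧
    ∀ g h : G, ∀ j k : Fin (d + 1), ‖f g j * f h k - f h k * f g j‖ < ε

/-- The Rokhlin dimension of a global action. -/
noncomputable def globalRokhlinDim (β : CStarGlobalAction G B) : ℕ∞ :=
  sInf {n : ℕ∞ | ∃ d : ℕ, n = d ∧ HasGlobalRokhlinDimLE β d}

/-- The Rokhlin dimension with commuting towers of a global action. -/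
noncomputable def globalRokhlinDimC (β : CStarGlobalAction G B) : ℕ∞ :=
  sInf {n : ℕ∞ | ∃ d : ℕ, n = d ∧ HasGlobalRokhlinDimCLE β d}

/-- The map `β_g` as a *-homomorphism. -/
def CStarGlobalAction.toHom (β : CStarGlobalAction G B) (g : G) : B →⋆ₙₐ[ℂ] B where
  toFun := β.act g
  map_smul' := β.map_smul g
  map_zero' := by simpa using β.map_smul g 0 0
  map_add' := β.map_add g
  map_mul' := β.map_mul g
  map_star' := β.map_star g

theorem CStarGlobalAction.norm_act_le {Γ : Type*} [Group Γ] (β : CStarGlobalAction Γ B)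
    (g : Γ) (x : B) :
    ‖β.act g x‖ ≤ ‖x‖ :=
  NonUnitalStarAlgHom.norm_apply_le (β.toHom g) x

theorem CStarGlobalAction.map_sum {Γ : Type*} [Group Γ] (β : CStarGlobalAction Γ B)
    (g : Γ) {ι : Type*}
    (s : Finset ι) (x : ι → B) : β.act g (∑ i ∈ s, x i) = ∑ i ∈ s, β.act g (x i) :=
  _root_.map_sum (β.toHom g) x s

theorem CStarGlobalAction.map_zero {Γ : Type*} [Group Γ] (β : CStarGlobalAction Γ B)
    (g : Γ) : β.act g 0 = 0 :=
  _root_.map_zero (β.toHom g)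

theorem CStarGlobalAction.act_inv_right {Γ : Type*} [Group Γ] (β : CStarGlobalAction Γ B)
    (g : Γ) (x : B) :
    β.act g (β.act g⁻¹ x) = x := by
  rw [← β.act_comp, mul_inv_cancel, β.act_one]

theorem CStarGlobalAction.map_one {Γ : Type*} [Group Γ] (β : CStarGlobalAction Γ B)
    (g : Γ) : β.act g 1 = 1 := by
  have h := β.map_mul g 1 (β.act g⁻¹ 1)
  rwa [one_mul, β.act_inv_right, mul_one, eq_comm] at h

theorem CStarGlobalAction.act_commute {Γ : Type*} [Group Γ] (β : CStarGlobalAction Γ B)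
    (g : Γ) {z : B}
    (hz : ∀ b, z * b = b * z) (b : B) : β.act g z * b = b * β.act g z := by
  rw [← β.act_inv_right g b, ← β.map_mul, ← β.map_mul, hz]

theorem exists_sum_eq_star_mul_self {ι : Type*} (s : Finset ι) (x : ι → B)
    (hx : ∀ i ∈ s, ∃ y, x i = star y * y) : ∃ y, ∑ i ∈ s, x i = star y * y := by
  let _ := CStarAlgebra.spectralOrder B
  let _ := CStarAlgebra.spectralOrderedRing B
  refine CStarAlgebra.nonneg_iff_eq_star_mul_self.mp (Finset.sum_nonneg fun i hi => ?_)
  exact CStarAlgebra.nonneg_iff_eq_star_mul_self.mpr (hx i hi)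

theorem norm_le_norm_sum_of_eq_star_mul_self {ι : Type*} (s : Finset ι) (x : ι → B)
    (hx : ∀ i ∈ s, ∃ y, x i = star y * y) {i : ι} (hi : i ∈ s) : ‖x i‖ ≤ ‖∑ i ∈ s, x i‖ := by
  let _ := CStarAlgebra.spectralOrder B
  let _ := CStarAlgebra.spectralOrderedRing B
  have h0 : ∀ i ∈ s, 0 ≤ x i := fun i hi => CStarAlgebra.nonneg_iff_eq_star_mul_self.mpr (hx i hi)
  exact CStarAlgebra.norm_le_norm_of_nonneg_of_le (h0 i hi) (Finset.single_le_sum h0 hi)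

theorem IsStarProjection.norm_le_one {p : B} (hp : IsStarProjection p) : ‖p‖ ≤ 1 := by
  have h : ‖p‖ * ‖p‖ = ‖p‖ := by
    rw [← CStarRing.norm_star_mul_self, hp.isSelfAdjoint.star_eq, hp.isIdempotentElem.eq]
  nlinarith [norm_nonneg p]

/-- A central idempotent of a C*-algebra is a projection. -/
theorem isStarProjection_of_central_idempotent {p : B} (hc : ∀ b, p * b = b * p)
    (hp : p * p = p) : IsStarProjection p := by
  have hs : star p * star p = star p := by rw [← star_mul, hp]
  have h0 : star (p - star p * p) * (p - star p * p) = 0 := by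
    have h1 : star p * p * p = star p * p := by rw [mul_assoc, hp]
    have h2 : star p * (star p * p) = star p * p := by rw [← mul_assoc, hs]
    have h3 : star p * p * (star p * p) = star p * p := by
      rw [mul_assoc, ← mul_assoc p, hc (star p), mul_assoc, hp, h2]
    rw [star_sub, star_mul, star_star, sub_mul, mul_sub, mul_sub, h1, h2, h3]
    simp
  have h1 : p = star p * p := sub_eq_zero.mp ((CStarRing.star_mul_self_eq_zero_iff _).mp h0)
  refine ⟨hp, ?_⟩
  rw [h1]
  exact IsSelfAdjoint.star_mul_self p

/-- Disjointification of a finite family of central idempotents. -/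
theorem exists_orthogonal_of_central_idempotents {ι : Type*} [Fintype ι] (p : ι → B)
    (hc : ∀ i b, p i * b = b * p i) (hp : ∀ i, p i * p i = p i) (s : Finset ι) :
    ∃ e : ι → B, (∀ i b, e i * b = b * e i) ∧ (∀ i, e i * e i = e i) ∧
      (∀ i, e i * p i = e i) ∧ (∀ i j, i ≠ j → e i * e j = 0) ∧ (∀ i, i ∉ s → e i = 0) ∧
      ∀ i ∈ s, (∑ j, e j) * p i = p i := by
  classical
  induction s using Finset.induction_on with
  | empty => exact ⟨0, by simp, by simp, by simp, by simp, by simp, by simp⟩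
  | insert a s ha ih =>
    obtain ⟨e, hec, hee, hep, heo, he0, hes⟩ := ih
    set E := ∑ j, e j with hE
    have hEc : ∀ b, E * b = b * E := fun b => by
      rw [hE, Finset.sum_mul, Finset.mul_sum]
      exact Finset.sum_congr rfl fun i _ => hec i b
    have heE : ∀ i, e i * E = e i := fun i => by
      rw [hE, Finset.mul_sum, Finset.sum_eq_single i (fun j _ hj => heo i j hj.symm) (by simp),
        hee]
    have hEE : E * E = E := by
      conv_rhs => rw [hE]
      conv_lhs => rw [hE, Finset.sum_mul]
      exact Finset.sum_congr rfl fun i _ => heE i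
    set q := p a * (1 - E) with hq
    have hqc : ∀ b, q * b = b * q := fun b => by
      rw [hq, mul_assoc, sub_mul, one_mul, hEc, ← mul_one_sub, ← mul_assoc, hc, mul_assoc]
    have heq : ∀ i, e i * q = 0 := fun i => by
      rw [hq, ← mul_assoc, ← hc, mul_assoc, mul_one_sub, heE, sub_self, mul_zero]
    have hqe : ∀ i, q * e i = 0 := fun i => by rw [hqc, heq]
    have hqq : q * q = q := by
      conv_lhs => rw [hq]
      rw [mul_assoc, ← hqc, hq, mul_assoc, mul_one_sub, mul_one_sub, sub_mul, hEE]
      rw [← mul_assoc, hp, one_mul, sub_self, sub_zero, mul_one_sub]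
    have hqp : q * p a = q := by
      rw [hqc, hq, ← mul_assoc, hp]
    have hsum : ∑ j, Function.update e a q j = E + q := by
      rw [Finset.sum_update_of_mem (Finset.mem_univ a), hE,
        ← Finset.add_sum_erase _ _ (Finset.mem_univ a), he0 a ha, zero_add, add_comm,
        Finset.sdiff_singleton_eq_erase]
    refine ⟨Function.update e a q, ?_, ?_, ?_, ?_, ?_, ?_⟩
    · intro i b
      by_cases h : i = a
      · subst h; simpa using hqc b
      · simpa [h] using hec i b
    · intro i
      by_cases h : i = a
      · subst h; simpa using hqq
      · simpa [h] using hee i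
    · intro i
      by_cases h : i = a
      · subst h; simpa using hqp
      · simpa [h] using hep i
    · intro i j hij
      by_cases h : i = a
      · subst h
        simpa [hij.symm] using hqe j
      · by_cases h' : j = a
        · subst h'
          simpa [h] using heq i
        · simpa [h, h'] using heo i j hij
    · intro i hi
      rw [Finset.mem_insert, not_or] at hi
      simpa [hi.1] using he0 i hi.2
    · intro i hi
      rw [hsum]
      rcases Finset.mem_insert.mp hi with rfl | hi
      · rw [add_mul, hqp, hq, mul_one_sub, hEc]
        abel
      · rw [add_mul, hes i hi, hq, mul_assoc, sub_mul, one_mul, hes i hi]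
        simp

/-- If the translates of a unital ideal `I` span `B`, there is an equivariant family `w` of central
projections such that `(w g k)_g` is a partition of unity for every `k`, and `w 1 k ∈ I`. -/
theorem exists_equivariant_central_partition
    (β : CStarGlobalAction G B) (I : Set B)
    (hImull : ∀ (b : B), ∀ x ∈ I, b * x ∈ I) (hImulr : ∀ (b : B), ∀ x ∈ I, x * b ∈ I)
    (eI : B) (heI : eI ∈ I) (hunit : ∀ x ∈ I, eI * x = x ∧ x * eI = x)
    (hspan : Dense (Submodule.span ℂ (⋃ g : G, β.act g '' I) : Set B)) :
    ∃ w : G → G → B, (∀ g k b, w g k * b = b * w g k) ∧ (∀ g k, IsStarProjection (w g k)) ∧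
      (∀ g g' k, g ≠ g' → w g k * w g' k = 0) ∧ (∀ l g k, β.act l (w g k) = w (l * g) (l * k)) ∧
      (∀ k, ∑ g, w g k = 1) ∧ ∀ k, w 1 k ∈ I := by
  have heIc : ∀ b, eI * b = b * eI := fun b => by
    rw [← (hunit _ (hImulr b _ heI)).2, mul_assoc, (hunit _ (hImull b _ heI)).1]
  obtain ⟨e, hec, hee, hep, heo, -, hes⟩ := exists_orthogonal_of_central_idempotents
    (fun g => β.act g eI) (fun g => β.act_commute g heIc)
    (fun g => by rw [← β.map_mul, (hunit _ heI).1]) Finset.univ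
  have hsum : ∑ j, e j = 1 := by
    have hle : (Submodule.span ℂ (⋃ g : G, β.act g '' I) : Set B) ⊆
        {x | (∑ j, e j) * x = x} := by
      intro x hx
      induction hx using Submodule.span_induction with
      | mem x hx =>
        obtain ⟨g, y, hy, rfl⟩ := Set.mem_iUnion.mp hx
        change (∑ j, e j) * β.act g y = β.act g y
        rw [← (hunit y hy).1, β.map_mul, ← mul_assoc, hes g (Finset.mem_univ g)]
      | zero => simp
      | add x y _ _ hx hy =>
        rw [Set.mem_ofPred_eq] at *
        rw [mul_add, hx, hy]
      | smul c x _ hx =>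
        rw [Set.mem_ofPred_eq] at *
        rw [mul_smul_comm, hx]
    have hcl : IsClosed {x | (∑ j, e j) * x = x} := isClosed_eq (by fun_prop) continuous_id
    have h1 := (hcl.closure_subset_iff.mpr hle) (hspan 1)
    simpa using h1
  have hwc : ∀ g k b, β.act k (e (k⁻¹ * g)) * b = b * β.act k (e (k⁻¹ * g)) :=
    fun g k => β.act_commute k (hec _)
  refine ⟨fun g k => β.act k (e (k⁻¹ * g)), hwc, fun g k => ?_, fun g g' k h => ?_,
    fun l g k => ?_, fun k => ?_, fun k => ?_⟩
  · exact isStarProjection_of_central_idempotent (hwc g k) (by rw [← β.map_mul, hee])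
  · change β.act k _ * β.act k _ = 0
    rw [← β.map_mul, heo _ _ (by simpa using h), β.map_zero]
  · change β.act l (β.act k _) = _
    rw [← β.act_comp]
    congr 2
    group
  · change ∑ g, β.act k (e (k⁻¹ * g)) = 1
    rw [← β.map_sum, Fintype.sum_equiv (Equiv.mulLeft k⁻¹) (fun g => e (k⁻¹ * g)) e
      (fun _ => rfl), hsum, β.map_one]
  · change β.act k (e (k⁻¹ * 1)) ∈ I
    rw [mul_one, ← hep k⁻¹, β.map_mul, β.act_inv_right]
    exact hImull _ _ heI

theorem norm_double_sum_le {ι κ E : Type*} [Fintype ι] [Fintype κ] [SeminormedAddCommGroup E]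
    (x : ι → κ → E) {c : ℝ} (hx : ∀ i j, ‖x i j‖ ≤ c) :
    ‖∑ i, ∑ j, x i j‖ ≤ Fintype.card ι * (Fintype.card κ * c) := by
  refine (norm_sum_le_of_le _ fun i _ => norm_sum_le_of_le _ fun j _ => hx i j).trans ?_
  simp

/-- Replacing the levels of a Rokhlin tower by the translates of its first level. -/
theorem GlobalRokhlinTowers.exact_bounds {β : CStarGlobalAction G B} {d : ℕ} {F : Finset B}
    {δ : ℝ} {f : G → Fin (d + 1) → B} (hf : GlobalRokhlinTowers β d F δ f) :
    (∀ j, ∀ k l, k ≠ l → ‖β.act k (f 1 j) * β.act l (f 1 j)‖ ≤ 3 * δ) ∧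
    (‖(∑ j, ∑ k, β.act k (f 1 j)) - 1‖ ≤ ((d + 1) * Fintype.card G + 1) * δ) ∧
    (∀ k j, ∀ b ∈ F, ‖β.act k (f 1 j) * b - b * β.act k (f 1 j)‖ ≤ (2 * ‖b‖ + 1) * δ) ∧
    ((∀ g h j k, ‖f g j * f h k - f h k * f g j‖ < δ) →
      ∀ g h j k, ‖β.act g (f 1 j) * β.act h (f 1 k) - β.act h (f 1 k) * β.act g (f 1 j)‖
        ≤ 5 * δ) := by
  obtain ⟨hpos, heq, horth, hsum, hcomm⟩ := hf
  have hn : ∀ g j, ‖f g j‖ ≤ 1 := fun g j => (hpos g j).2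
  have ht : ∀ g j, ‖β.act g (f 1 j)‖ ≤ 1 := fun g j => (β.norm_act_le g _).trans (hn 1 j)
  have hd : ∀ g j, ‖β.act g (f 1 j) - f g j‖ ≤ δ := fun g j => by
    simpa using (heq g 1 j).le
  have hδ : 0 ≤ δ := (norm_nonneg _).trans (hd 1 0)
  have hprod : ∀ g h j k, ‖β.act g (f 1 j) * β.act h (f 1 k) - f g j * f h k‖ ≤ 2 * δ := by
    intro g h j k
    have : β.act g (f 1 j) * β.act h (f 1 k) - f g j * f h k =
        β.act g (f 1 j) * (β.act h (f 1 k) - f h k) + (β.act g (f 1 j) - f g j) * f h k := by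
      noncomm_ring
    rw [this]
    refine (norm_add_le_of_le (norm_mul_le_of_le (ht g j) (hd h k))
      (norm_mul_le_of_le (hd g j) (hn h k))).trans (by linarith)
  refine ⟨fun j k l hkl => ?_, ?_, fun k j b hb => ?_, fun hc g h j k => ?_⟩
  · rw [← sub_add_cancel (β.act k (f 1 j) * β.act l (f 1 j)) (f k j * f l j)]
    refine (norm_add_le_of_le (hprod k l j j) (horth j k l hkl).le).trans (by linarith)
  · have h1 : (∑ j, ∑ k, β.act k (f 1 j)) - 1 =
        (∑ j, ∑ k, (β.act k (f 1 j) - f k j)) + ((∑ j, ∑ k, f k j) - 1) := by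
      simp only [Finset.sum_sub_distrib]
      abel
    have h2 := norm_double_sum_le (fun j k => β.act k (f 1 j) - f k j) fun j k => hd k j
    rw [h1]
    refine (norm_add_le_of_le h2 hsum.le).trans (le_of_eq ?_)
    rw [Fintype.card_fin]
    push_cast
    ring
  · have h1 : β.act k (f 1 j) * b - b * β.act k (f 1 j) = (β.act k (f 1 j) - f k j) * b
        - b * (β.act k (f 1 j) - f k j) + (f k j * b - b * f k j) := by noncomm_ring
    rw [h1]
    refine (norm_add_le_of_le (norm_sub_le_of_le (norm_mul_le_of_le (hd k j) le_rfl)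
      (norm_mul_le_of_le le_rfl (hd k j))) (hcomm k j b hb).le).trans (by linarith)
  · have h1 : β.act g (f 1 j) * β.act h (f 1 k) - β.act h (f 1 k) * β.act g (f 1 j) =
        (β.act g (f 1 j) * β.act h (f 1 k) - f g j * f h k)
        - (β.act h (f 1 k) * β.act g (f 1 j) - f h k * f g j)
        + (f g j * f h k - f h k * f g j) := by abel
    rw [h1]
    refine (norm_add_le_of_le (norm_sub_le_of_le (hprod g h j k) (hprod h g k j))
      (hc g h j k).le).trans (by linarith)

/-- Exactly equivariant towers with first level in the ideal, before fixing the tolerance. -/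
theorem exists_exact_towers_of_first_level
    (β : CStarGlobalAction G B) (d : ℕ)
    (I : Set B) (hI0 : (0 : B) ∈ I) (hIadd : ∀ x ∈ I, ∀ y ∈ I, x + y ∈ I)
    (hIsmul : ∀ (c : ℂ), ∀ x ∈ I, c • x ∈ I)
    (hImull : ∀ (b : B), ∀ x ∈ I, b * x ∈ I)
    (hImulr : ∀ (b : B), ∀ x ∈ I, x * b ∈ I)
    (eI : B) (heI : eI ∈ I) (hunit : ∀ x ∈ I, eI * x = x ∧ x * eI = x)
    (hspan : Dense (Submodule.span ℂ (⋃ g : G, β.act g '' I) : Set B))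
    (F : Finset B) (η : ℝ) (hη : 0 ≤ η) (a : Fin (d + 1) → B) (ha : ∀ j, ∃ y, a j = star y * y)
    (horth : ∀ j, ∀ k l, k ≠ l → ‖β.act k (a j) * β.act l (a j)‖ ≤ η)
    (hsum : ‖(∑ j, ∑ k, β.act k (a j)) - 1‖ ≤ η)
    (hcomm : ∀ k j, ∀ b ∈ F, ‖β.act k (a j) * b - b * β.act k (a j)‖ ≤ η) :
    ∃ f : G → Fin (d + 1) → B,
      (∀ g j, IsPosContraction (f g j)) ∧
      (∀ j, f 1 j ∈ I) ∧
      (∀ g h : G, ∀ j, β.act g (f h j) = f (g * h) j) ∧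
      (∀ j, ∀ g h : G, g ≠ h → ‖f g j * f h j‖ ≤ Fintype.card G * (Fintype.card G * η)) ∧
      (‖(1 : B) - ∑ j : Fin (d + 1), ∑ g : G, f g j‖ ≤ 2 * η) ∧
      (∀ g j, ∀ b ∈ F, ‖f g j * b - b * f g j‖ ≤ Fintype.card G * η) ∧
      ((∀ g h j k, ‖β.act g (a j) * β.act h (a k) - β.act h (a k) * β.act g (a j)‖ ≤ η) →
        ∀ g h j k, ‖f g j * f h k - f h k * f g j‖ ≤ Fintype.card G * (Fintype.card G * η)) := by
  obtain ⟨w, hwc, hwp, hwo, hwe, hws, hwI⟩ :=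
    exists_equivariant_central_partition β I hImull hImulr eI heI hunit hspan
  have hwn : ∀ g k, ‖w g k‖ ≤ 1 := fun g k => (hwp g k).norm_le_one
  set c : ℝ := (1 + η)⁻¹ with hc
  have hc0 : 0 < c := by positivity
  have hc1 : c ≤ 1 := inv_le_one_of_one_le₀ (by linarith)
  have hcη : c * (1 + η) = 1 := inv_mul_cancel₀ (by positivity)
  have hcn : ‖(c : ℂ)‖ = c := by simp [abs_of_pos hc0]
  set s : G → Fin (d + 1) → B := fun g j => ∑ k, β.act k (a j) * w g k with hs
  have hspos : ∀ g j, ∃ y, s g j = star y * y := by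
    intro g j
    refine exists_sum_eq_star_mul_self _ _ fun k _ => ?_
    obtain ⟨y, hy⟩ := ha j
    refine ⟨β.act k y * w g k, ?_⟩
    rw [hy, star_mul, (hwp g k).isSelfAdjoint.star_eq, β.map_mul, β.map_star, mul_assoc,
      mul_assoc, hwc, mul_assoc, mul_assoc, (hwp g k).isIdempotentElem.eq]
  have hssum : ∀ j, ∑ g, s g j = ∑ k, β.act k (a j) := by
    intro j
    rw [hs, Finset.sum_comm]
    refine Finset.sum_congr rfl fun k _ => ?_
    rw [← Finset.mul_sum, hws, mul_one]
  have hone : ‖(1 : B)‖ ≤ 1 := (IsStarProjection.one B).norm_le_one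
  have hsn : ∀ g j, ‖s g j‖ ≤ 1 + η := by
    intro g j
    have h1 := norm_le_norm_sum_of_eq_star_mul_self Finset.univ (fun g => s g j)
      (fun g _ => hspos g j) (Finset.mem_univ g)
    have h2 := norm_le_norm_sum_of_eq_star_mul_self Finset.univ (fun j => ∑ g, s g j)
      (fun j _ => exists_sum_eq_star_mul_self _ _ fun g _ => hspos g j) (Finset.mem_univ j)
    refine (h1.trans h2).trans ?_
    simp only [hssum]
    rw [← add_sub_cancel 1 (∑ j, ∑ k, β.act k (a j))]
    exact norm_add_le_of_le hone hsum
  have hsorth : ∀ j, ∀ g h : G, g ≠ h →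
      ‖s g j * s h j‖ ≤ Fintype.card G * (Fintype.card G * η) := by
    intro j g h hgh
    rw [hs]
    simp only [Finset.sum_mul_sum]
    refine norm_double_sum_le _ fun k l => ?_
    have h1 : β.act k (a j) * w g k * (β.act l (a j) * w h l) =
        β.act k (a j) * β.act l (a j) * (w g k * w h l) := by
      rw [mul_assoc, ← mul_assoc (w g k), hwc g k (β.act l (a j))]
      simp only [mul_assoc]
    rw [h1]
    by_cases hkl : k = l
    · subst hkl
      rw [hwo g h k hgh, mul_zero, norm_zero]
      exact hη
    · exact (norm_mul_le_of_le (horth j k l hkl)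
        (norm_mul_le_of_le (hwn g k) (hwn h l))).trans (by simp)
  have hscomm : ∀ g j, ∀ b ∈ F, ‖s g j * b - b * s g j‖ ≤ Fintype.card G * η := by
    intro g j b hb
    have h1 : s g j * b - b * s g j = ∑ k, (β.act k (a j) * b - b * β.act k (a j)) * w g k := by
      rw [hs]
      simp only [Finset.sum_mul, Finset.mul_sum, ← Finset.sum_sub_distrib]
      refine Finset.sum_congr rfl fun k _ => ?_
      rw [mul_assoc, hwc, sub_mul]
      simp only [mul_assoc]
    rw [h1]
    refine (norm_sum_le_of_le _ fun k _ =>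
      norm_mul_le_of_le (hcomm k j b hb) (hwn g k)).trans (by simp)
  have hscommC :
      (∀ g h j k, ‖β.act g (a j) * β.act h (a k) - β.act h (a k) * β.act g (a j)‖ ≤ η) →
        ∀ g h j k, ‖s g j * s h k - s h k * s g j‖ ≤ Fintype.card G * (Fintype.card G * η) := by
    intro hC g h j k
    have h1 : s g j * s h k - s h k * s g j = ∑ l, ∑ m,
        (β.act l (a j) * β.act m (a k) - β.act m (a k) * β.act l (a j)) * (w g l * w h m) := by
      rw [hs]
      simp only [Finset.sum_mul_sum]
      rw [Finset.sum_comm (f := fun m l => β.act m (a k) * w h m * (β.act l (a j) * w g l))]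
      simp only [← Finset.sum_sub_distrib]
      refine Finset.sum_congr rfl fun l _ => Finset.sum_congr rfl fun m _ => ?_
      rw [sub_mul]
      congr 1
      · rw [mul_assoc, ← mul_assoc (w g l), hwc g l (β.act m (a k))]
        simp only [mul_assoc]
      · rw [mul_assoc, ← mul_assoc (w h m), hwc h m (β.act l (a j)), hwc g l (w h m)]
        simp only [mul_assoc]
    rw [h1]
    refine norm_double_sum_le _ fun l m => ?_
    exact (norm_mul_le_of_le (hC l m j k) (norm_mul_le_of_le (hwn g l) (hwn h m))).trans (by simp)
  have hscale : ∀ {x : B} {r : ℝ}, ‖x‖ ≤ r → ‖(c : ℂ) • x‖ ≤ r := by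
    intro x r hx
    rw [norm_smul, hcn]
    exact (mul_le_of_le_one_left (norm_nonneg x) hc1).trans hx
  refine ⟨fun g j => (c : ℂ) • s g j, fun g j => ⟨?_, ?_⟩, fun j => ?_, fun g h j => ?_,
    fun j g h hgh => ?_, ?_, fun g j b hb => ?_, fun hC g h j k => ?_⟩
  · obtain ⟨y, hy⟩ := hspos g j
    refine ⟨((√c : ℝ) : ℂ) • y, ?_⟩
    change (c : ℂ) • s g j = _
    rw [hy, star_smul, smul_mul_smul_comm, Complex.star_def, Complex.conj_ofReal,
      ← Complex.ofReal_mul, Real.mul_self_sqrt hc0.le]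
  · rw [norm_smul, hcn, ← hcη]
    exact mul_le_mul_of_nonneg_left (hsn g j) hc0.le
  · refine hIsmul _ _ ?_
    exact Finset.sum_induction _ (· ∈ I) (fun x y hx hy => hIadd x hx y hy) hI0
      fun k _ => hImull _ _ (hwI k)
  · rw [β.map_smul, hs]
    simp only [β.map_sum, β.map_mul, hwe, ← β.act_comp]
    congr 1
    exact Fintype.sum_equiv (Equiv.mulLeft g) _ (fun k => β.act k (a j) * w (g * h) k)
      fun _ => rfl
  · rw [smul_mul_assoc, mul_smul_comm]
    exact hscale (hscale (hsorth j g h hgh))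
  · simp only [← Finset.smul_sum, hssum]
    have h1 : (1 : B) - (c : ℂ) • ∑ j, ∑ k, β.act k (a j) =
        ((1 - c : ℝ) : ℂ) • (1 : B) - (c : ℂ) • ((∑ j, ∑ k, β.act k (a j)) - 1) := by
      rw [smul_sub, Complex.ofReal_sub, sub_smul, Complex.ofReal_one, one_smul]
      abel
    have h2 : ‖((1 - c : ℝ) : ℂ) • (1 : B)‖ ≤ η := by
      rw [norm_smul, Complex.norm_real, Real.norm_of_nonneg (by linarith)]
      calc (1 - c) * ‖(1 : B)‖ ≤ 1 - c := mul_le_of_le_one_right (by linarith) hone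
        _ = c * η := by linarith
        _ ≤ η := mul_le_of_le_one_left hη hc1
    rw [h1]
    exact (norm_sub_le_of_le h2 (hscale hsum)).trans (by linarith)
  · rw [smul_mul_assoc, mul_smul_comm, ← smul_sub]
    exact hscale (hscomm g j b hb)
  · simp only [smul_mul_assoc, mul_smul_comm, ← smul_sub]
    exact hscale (hscale (hscommC hC g h j k))

theorem mem_of_sInf_eq_natCast {P : ℕ → Prop} {d : ℕ}
    (h : sInf {n : ℕ∞ | ∃ m : ℕ, n = m ∧ P m} = (d : ℕ∞)) : P d := by
  have hne : {n : ℕ∞ | ∃ m : ℕ, n = m ∧ P m}.Nonempty := by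
    by_contra hemp
    rw [Set.not_nonempty_iff_eq_empty.mp hemp, sInf_empty] at h
    exact ENat.top_ne_natCast d h
  obtain ⟨m, hm, hP⟩ := csInf_mem hne
  rw [h, Nat.cast_inj] at hm
  exact hm ▸ hP

/-- If `β` is a global action of a finite group `G` on a unital C*-algebra
`B` with `dim_Rok(β) = d < ∞`, and `A = I` is a closed two-sided ideal of `B` with a unit
such that `B` is the closed linear span of `{β_g(a) : a ∈ I, g ∈ G}`, then for all `ε > 0`
and finite `F ⊆ B` there are exactly equivariant Rokhlin towers `f g j` for `β` with
`f 1 j ∈ I`; moreover if `dim_Rok^c(β) = d` they can be chosen approximately commuting. -/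
theorem exists_exact_towers_with_first_level_in_ideal
    (β : CStarGlobalAction G B) (d : ℕ)
    (I : Set B) (hIclosed : IsClosed I) (hI0 : (0 : B) ∈ I)
    (hIadd : ∀ x ∈ I, ∀ y ∈ I, x + y ∈ I)
    (hIsmul : ∀ (c : ℂ), ∀ x ∈ I, c • x ∈ I)
    (hImull : ∀ (b : B), ∀ x ∈ I, b * x ∈ I)
    (hImulr : ∀ (b : B), ∀ x ∈ I, x * b ∈ I)
    (eI : B) (heI : eI ∈ I) (hunit : ∀ x ∈ I, eI * x = x ∧ x * eI = x)
    (hspan : Dense (Submodule.span ℂ (⋃ g : G, β.act g '' I) : Set B)) :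
    (globalRokhlinDim β = (d : ℕ∞) →
      ∀ ε > (0 : ℝ), ∀ F : Finset B, ∃ f : G → Fin (d + 1) → B,
        (∀ g j, IsPosContraction (f g j)) ∧
        (∀ j, f 1 j ∈ I) ∧
        (∀ g h : G, ∀ j, β.act g (f h j) = f (g * h) j) ∧
        (∀ j, ∀ g h : G, g ≠ h → ‖f g j * f h j‖ < ε) ∧
        (‖(1 : B) - ∑ j : Fin (d + 1), ∑ g : G, f g j‖ ≤ ε) ∧
        (∀ g j, ∀ b ∈ F, ‖f g j * b - b * f g j‖ < ε)) ∧
    (globalRokhlinDimC β = (d : ℕ∞) →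
      ∀ ε > (0 : ℝ), ∀ F : Finset B, ∃ f : G → Fin (d + 1) → B,
        (∀ g j, IsPosContraction (f g j)) ∧
        (∀ j, f 1 j ∈ I) ∧
        (∀ g h : G, ∀ j, β.act g (f h j) = f (g * h) j) ∧
        (∀ j, ∀ g h : G, g ≠ h → ‖f g j * f h j‖ < ε) ∧
        (‖(1 : B) - ∑ j : Fin (d + 1), ∑ g : G, f g j‖ ≤ ε) ∧
        (∀ g j, ∀ b ∈ F, ‖f g j * b - b * f g j‖ < ε) ∧
        (∀ g h : G, ∀ j k : Fin (d + 1), ‖f g j * f h k - f h k * f g j‖ < ε)) := by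
  have key : ∀ ε > (0 : ℝ), ∀ F : Finset B, ∃ δ > 0, ∀ t : G → Fin (d + 1) → B,
      GlobalRokhlinTowers β d F δ t → ∃ f : G → Fin (d + 1) → B,
        (∀ g j, IsPosContraction (f g j)) ∧
        (∀ j, f 1 j ∈ I) ∧
        (∀ g h : G, ∀ j, β.act g (f h j) = f (g * h) j) ∧
        (∀ j, ∀ g h : G, g ≠ h → ‖f g j * f h j‖ < ε) ∧
        (‖(1 : B) - ∑ j : Fin (d + 1), ∑ g : G, f g j‖ ≤ ε) ∧
        (∀ g j, ∀ b ∈ F, ‖f g j * b - b * f g j‖ < ε) ∧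
        ((∀ g h j k, ‖t g j * t h k - t h k * t g j‖ < δ) →
          ∀ g h : G, ∀ j k : Fin (d + 1), ‖f g j * f h k - f h k * f g j‖ < ε) := by
    intro ε hε F
    set n : ℝ := (Fintype.card G : ℝ) with hn
    have hn1 : 1 ≤ n := by
      rw [hn]
      exact_mod_cast Fintype.card_pos (α := G)
    set C : ℝ := 5 + ((d + 1) * n + 1) + ∑ b ∈ F, 2 * ‖b‖ with hC
    have hF0 : 0 ≤ ∑ b ∈ F, 2 * ‖b‖ := Finset.sum_nonneg fun b _ => by positivity
    have hdn : 0 ≤ ((d : ℝ) + 1) * n := by positivity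
    have hC0 : 0 < C := by linarith
    set η : ℝ := ε / (4 * n * n) with hη
    have hη0 : 0 < η := by positivity
    have hηε : 4 * (n * (n * η)) = ε := by
      rw [hη]
      field_simp
    have hn2 : n * η ≤ n * (n * η) := mul_le_mul_of_nonneg_left
      (le_mul_of_one_le_left hη0.le hn1) (by linarith)
    have hn3 : η ≤ n * η := le_mul_of_one_le_left hη0.le hn1
    have hδ0 : 0 < η / C := by positivity
    have hbound : ∀ {r : ℝ}, r ≤ C → r * (η / C) ≤ η := by
      intro r hr
      calc r * (η / C) ≤ C * (η / C) := mul_le_mul_of_nonneg_right hr hδ0.le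
        _ = η := mul_div_cancel₀ η hC0.ne'
    refine ⟨η / C, hδ0, fun t ht => ?_⟩
    obtain ⟨h1, h2, h3, h4⟩ := ht.exact_bounds
    obtain ⟨f, hf1, hf2, hf3, hf4, hf5, hf6, hf7⟩ := exists_exact_towers_of_first_level β d I hI0
      hIadd hIsmul hImull hImulr eI heI hunit hspan F η hη0.le (t 1) (fun j => (ht.1 1 j).1)
      (fun j k l hkl => (h1 j k l hkl).trans (hbound (by linarith)))
      (h2.trans (hbound (by linarith)))
      (fun k j b hb => (h3 k j b hb).trans (hbound (by
        have := Finset.single_le_sum (f := fun b : B => 2 * ‖b‖)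
          (fun b _ => by positivity) hb
        linarith)))
    exact ⟨f, hf1, hf2, hf3, fun j g h hgh => (hf4 j g h hgh).trans_lt (by linarith),
      hf5.trans (by linarith), fun g j b hb => (hf6 g j b hb).trans_lt (by linarith),
      fun hc g h j k => (hf7 (fun g h j k => (h4 hc g h j k).trans (hbound (by linarith)))
        g h j k).trans_lt (by linarith)⟩
  refine ⟨fun hdim ε hε F => ?_, fun hdim ε hε F => ?_⟩
  · obtain ⟨δ, hδ, H⟩ := key ε hε F
    have hdim' : HasGlobalRokhlinDimLE β d := mem_of_sInf_eq_natCast hdim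
    obtain ⟨t, ht⟩ := hdim' δ hδ F
    obtain ⟨f, h1, h2, h3, h4, h5, h6, -⟩ := H t ht
    exact ⟨f, h1, h2, h3, h4, h5, h6⟩
  · obtain ⟨δ, hδ, H⟩ := key ε hε F
    have hdim' : HasGlobalRokhlinDimCLE β d := mem_of_sInf_eq_natCast hdim
    obtain ⟨t, ht, htc⟩ := hdim' δ hδ F
    obtain ⟨f, h1, h2, h3, h4, h5, h6, h7⟩ := H t ht
    exact ⟨f, h1, h2, h3, h4, h5, h6, h7 htc⟩
end

section
/- Let α be a unital partial action of a finite group G on a C*-algebra A (so in particular A = A_1 is unital), and set x_α = Σ_{g∈G} 1_g, where 1_g is the unit of A_g. Then x_α is a central positive element of A with x_α ≥ 1 (hence invertible), and x_α belongs to the fixed point algebra A^α. -/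
namespace CStarPartialAction

variable {G : Type*} [Group G] {A : Type*} [NonUnitalCStarAlgebra A]
  (α : CStarPartialAction G A)

theorem act_zero (g : G) : α.act g 0 = 0 := by
  simpa using α.act_add g 0 (α.zero_mem _) 0 (α.zero_mem _)

theorem sum_mem_and_act_sum {ι : Type*} (g : G) (s : Finset ι) (f : ι → A)
    (hf : ∀ i, f i ∈ α.dom g⁻¹) :
    ∑ i ∈ s, f i ∈ α.dom g⁻¹ ∧ α.act g (∑ i ∈ s, f i) = ∑ i ∈ s, α.act g (f i) := by
  classical
  induction s using Finset.induction_on with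
  | empty => simp [α.zero_mem, α.act_zero]
  | insert i s hi ih =>
    rw [Finset.sum_insert hi, Finset.sum_insert hi, ← ih.2]
    exact ⟨α.add_mem _ _ (hf i) _ ih.1, α.act_add _ _ (hf i) _ ih.1⟩

theorem act_act_inv (g : G) {y : A} (hy : y ∈ α.dom g) : α.act g (α.act g⁻¹ y) = y := by
  simpa using α.act_inv_act g⁻¹ y (by simpa using hy)

variable {e : G → A}

theorem unit_mul_comm_s8 (he : ∀ g, e g ∈ α.dom g)
    (hunit : ∀ g, ∀ x ∈ α.dom g, e g * x = x ∧ x * e g = x)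
    (g : G) (a : A) : e g * a = a * e g := by
  rw [← (hunit g _ (α.mul_mem_right g a _ (he g))).2, mul_assoc,
    (hunit g _ (α.mul_mem_left g a _ (he g))).1]

theorem isStarProjection_unit (he : ∀ g, e g ∈ α.dom g)
    (hunit : ∀ g, ∀ x ∈ α.dom g, e g * x = x ∧ x * e g = x)
    (g : G) : IsStarProjection (e g) where
  isIdempotentElem := (hunit g _ (he g)).1
  isSelfAdjoint := by
    have h := (hunit g _ (α.star_mem g _ (he g))).1
    have h' := congrArg star h
    rw [star_mul, star_star, h] at h'
    exact h'

/-- The isomorphism `act g` carries multiplication by `1_h` to multiplication by `1_{gh}`. -/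
theorem act_unit_mul (he : ∀ g, e g ∈ α.dom g)
    (hunit : ∀ g, ∀ x ∈ α.dom g, e g * x = x ∧ x * e g = x)
    (g h : G) {a : A} (ha : a ∈ α.dom g⁻¹) :
    α.act g (e h * a) = e (g * h) * α.act g a := by
  set q := e h * e g⁻¹ with hq
  set b := e (g * h) * α.act g a with hb
  set c := α.act g⁻¹ b with hc
  have hqg : q ∈ α.dom g⁻¹ := α.mul_mem_left _ _ _ (he _)
  have hqh : q ∈ α.dom h := α.mul_mem_right _ _ _ (he _)
  have hbg : b ∈ α.dom g := α.mul_mem_left _ _ _ (α.act_mem _ _ ha)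
  have hbgh : b ∈ α.dom (g * h) := α.mul_mem_right _ _ _ (he _)
  have hcm : c ∈ α.dom g⁻¹ ∩ α.dom h := by
    simpa using α.act_inter_mem g⁻¹ (g * h) b ⟨by simpa using hbg, hbgh⟩
  have hqc : q * c = c := by
    rw [hq, mul_assoc, (hunit _ _ hcm.1).1, (hunit _ _ hcm.2).1]
  have hqa : e h * a = q * a := by
    rw [hq, mul_assoc, (hunit _ _ ha).1]
  have hp := (hunit _ _ (α.act_inter_mem g h q ⟨hqg, hqh⟩).2).2
  calc α.act g (e h * a) = α.act g q * α.act g a := by rw [hqa, α.act_mul _ _ hqg _ ha]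
    _ = α.act g q * b := by rw [hb, ← mul_assoc, hp]
    _ = α.act g q * α.act g c := by rw [hc, α.act_act_inv g hbg]
    _ = α.act g c := by rw [← α.act_mul _ _ hqg _ hcm.1, hqc]
    _ = b := α.act_act_inv g hbg

theorem act_sum_units_mul [Fintype G] (he : ∀ g, e g ∈ α.dom g)
    (hunit : ∀ g, ∀ x ∈ α.dom g, e g * x = x ∧ x * e g = x)
    (g : G) {a : A} (ha : a ∈ α.dom g⁻¹) :
    α.act g ((∑ h : G, e h) * a) = (∑ h : G, e h) * α.act g a := by
  rw [Finset.sum_mul, (α.sum_mem_and_act_sum g _ _ fun h => α.mul_mem_left _ _ _ ha).2,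
    Finset.sum_mul]
  simp_rw [α.act_unit_mul he hunit g _ ha]
  exact Equiv.sum_comp (Equiv.mulLeft g) fun h => e h * α.act g a

end CStarPartialAction

/-- For a unital partial action `α` of a finite group `G` on a C*-algebra
`A` (units `e g ∈ α.dom g`), the element `x_α = Σ_{g ∈ G} 1_g` is central, positive,
satisfies `1 ≤ x_α` (hence is invertible), and lies in the fixed point algebra `A^α`. -/
theorem sum_of_units_central_positive_invertible_fixed
    {G : Type*} [Group G] [Fintype G] {A : Type*} [CStarAlgebra A]
    [PartialOrder A] [StarOrderedRing A]
    (α : CStarPartialAction G A) (e : G → A)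
    (he : ∀ g, e g ∈ α.dom g)
    (hunit : ∀ g, ∀ x ∈ α.dom g, e g * x = x ∧ x * e g = x) :
    (∀ a : A, (∑ g : G, e g) * a = a * ∑ g : G, e g) ∧
    (0 ≤ ∑ g : G, e g) ∧
    ((1 : A) ≤ ∑ g : G, e g) ∧
    IsUnit (∑ g : G, e g) ∧
    (∀ g : G, ∀ a ∈ α.dom g⁻¹,
      α.act g ((∑ h : G, e h) * a) = (∑ h : G, e h) * α.act g a) := by
  have hnonneg (g : G) : 0 ≤ e g := (α.isStarProjection_unit he hunit g).nonneg
  have he1 : e 1 = 1 := by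
    simpa using (hunit 1 1 (by simp [α.dom_one])).1
  have hle : (1 : A) ≤ ∑ g : G, e g :=
    he1 ▸ Finset.single_le_sum (fun g _ => hnonneg g) (Finset.mem_univ 1)
  refine ⟨fun a => ?_, Finset.sum_nonneg fun g _ => hnonneg g, hle,
    CStarAlgebra.isUnit_of_le 1 hle, fun g a ha => α.act_sum_units_mul he hunit g ha⟩
  rw [Finset.sum_mul, Finset.mul_sum]
  exact Finset.sum_congr rfl fun g _ => α.unit_mul_comm_s8 he hunit g a
end

section
/- Let α be a partial action of a finite group G on a unital commutative C*-algebra A, and let d ∈ ℕ. Then dim_Rok(α) ≤ d if and only if for every ε > 0 and every finite subset F ⊆ A there exist positive contractions f_g^(j) ∈ A_g (g ∈ G, j = 0,…,d) satisfying: (1) ‖α_g(f_h^(j) a) − f_{gh}^(j) α_g(a)‖ < ε for all g, h ∈ G, all j = 0,…,d, and all a ∈ F ∩ A_{g⁻¹}; (2) f_g^(j) f_h^(j) = 0 (exactly) for all g ≠ h in G and all j = 0,…,d; (3) ‖Σ_{g∈G} Σ_{j=0}^d f_g^(j) − 1‖ < ε. -/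
variable {G : Type*} [Group G] [Fintype G] {A : Type*} [NonUnitalCStarAlgebra A]

/-- The action on each domain of a partial action is contractive. -/
lemma CStarPartialAction.norm_act_le {G : Type*} [Group G] {A : Type*}
    [NonUnitalCStarAlgebra A] (α : CStarPartialAction G A) (g : G) {x : A}
    (hx : x ∈ α.dom g⁻¹) : ‖α.act g x‖ ≤ ‖x‖ := by
  let S : NonUnitalStarSubalgebra ℂ A :=
    { carrier := α.dom g⁻¹
      add_mem' := fun {a b} ha hb => α.add_mem _ a ha b hb
      zero_mem' := α.zero_mem _
      mul_mem' := fun {a b} _ hb => α.mul_mem_left _ a b hb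
      smul_mem' := fun c a ha => α.smul_mem _ c a ha
      star_mem' := fun {a} ha => α.star_mem _ a ha }
  have : IsClosed (S : Set A) := α.dom_isClosed _
  let φ : S →⋆ₙₐ[ℂ] A :=
    { toFun := fun a => α.act g a
      map_smul' := fun c a => α.act_smul g c a a.2
      map_zero' := by
        have h := α.act_smul g 0 0 (α.zero_mem _)
        simpa using h
      map_add' := fun a b => α.act_add g a a.2 b b.2
      map_mul' := fun a b => α.act_mul g a a.2 b b.2
      map_star' := fun a => α.act_star g a a.2 }
  exact NonUnitalStarAlgHom.norm_apply_le φ (⟨x, hx⟩ : S)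

lemma CStarPartialAction.neg_mem {G : Type*} [Group G] {A : Type*}
    [NonUnitalCStarAlgebra A] (α : CStarPartialAction G A) (g : G) {x : A}
    (hx : x ∈ α.dom g) : -x ∈ α.dom g := by
  simpa using α.smul_mem g (-1) x hx

lemma CStarPartialAction.sub_mem {G : Type*} [Group G] {A : Type*}
    [NonUnitalCStarAlgebra A] (α : CStarPartialAction G A) (g : G) {x y : A}
    (hx : x ∈ α.dom g) (hy : y ∈ α.dom g) : x - y ∈ α.dom g := by
  simpa [sub_eq_add_neg] using α.add_mem g x hx _ (α.neg_mem g hy)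

lemma CStarPartialAction.act_sub {G : Type*} [Group G] {A : Type*}
    [NonUnitalCStarAlgebra A] (α : CStarPartialAction G A) (g : G) {x y : A}
    (hx : x ∈ α.dom g⁻¹) (hy : y ∈ α.dom g⁻¹) :
    α.act g (x - y) = α.act g x - α.act g y := by
  have h := α.act_add g _ (α.sub_mem _ hx hy) y hy
  rw [sub_add_cancel] at h
  exact eq_sub_of_add_eq h.symm

/-- Almost orthogonal families of positive contractions in `C(X, ℂ)` can be cut down to
exactly orthogonal ones by multiplication with positive contractions. -/
lemma ContinuousMap.exists_orthogonal_cutdown {X ι : Type*} [TopologicalSpace X]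
    [CompactSpace X] [Fintype ι] {η : ℝ} (hη : 0 < η) (b : ι → C(X, ℂ))
    (hb : ∀ i j, i ≠ j → ‖(star (b i) * b i) * (star (b j) * b j)‖ ≤
      η ^ 2 / (2 * (Fintype.card ι + 1))) :
    ∃ s : ι → C(X, ℂ), (∀ i, ‖star (s i) * s i‖ ≤ 1) ∧
      (∀ i j, i ≠ j →
        (star (b i) * b i) * (star (s i) * s i) * ((star (b j) * b j) * (star (s j) * s j)) = 0) ∧
      ∀ i, ‖star (b i) * b i - (star (b i) * b i) * (star (s i) * s i)‖ ≤ η := by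
  classical
  let t : ι → X → ℝ := fun i x => ‖b i x‖ ^ 2
  have ht0 (i x) : 0 ≤ t i x := by positivity
  have htc (i) : Continuous (t i) := by fun_prop
  let S : ι → X → ℝ := fun i x => ∑ j ∈ Finset.univ.erase i, t j x
  let r : ι → X → ℝ := fun i x => min 1 (max (2 / η * (t i x - S i x)) 0)
  have hr0 (i x) : 0 ≤ r i x := le_min zero_le_one (le_max_right _ _)
  have hr1 (i x) : r i x ≤ 1 := min_le_left _ _
  have hrc (i) : Continuous (r i) := by fun_prop
  have hr_zero {i x} (h : t i x ≤ S i x) : r i x = 0 := by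
    have : 2 / η * (t i x - S i x) ≤ 0 :=
      mul_nonpos_of_nonneg_of_nonpos (by positivity) (by linarith)
    simp [r, max_eq_right this]
  let s : ι → C(X, ℂ) := fun i => ⟨fun x => (√(r i x) : ℂ), by fun_prop⟩
  have hs (i x) : (star (s i) * s i) x = (r i x : ℂ) := by
    have : (√(r i x) : ℂ) * (√(r i x) : ℂ) = (r i x : ℂ) := by
      rw [← Complex.ofReal_mul, Real.mul_self_sqrt (hr0 i x)]
    simpa [s] using this
  have hbt (i x) : (star (b i) * b i) x = (t i x : ℂ) := by
    simp [t, Complex.conj_mul']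
  have htt (i j x) (hij : i ≠ j) : t i x * t j x ≤ η ^ 2 / (2 * (Fintype.card ι + 1)) := by
    have h := (ContinuousMap.norm_coe_le_norm _ x).trans (hb i j hij)
    rw [ContinuousMap.mul_apply, hbt, hbt, ← Complex.ofReal_mul, Complex.norm_real,
      Real.norm_of_nonneg (mul_nonneg (ht0 i x) (ht0 j x))] at h
    exact h
  have htS (i x) : t i x * S i x ≤ η ^ 2 / 2 := by
    calc t i x * S i x = ∑ j ∈ Finset.univ.erase i, t i x * t j x := Finset.mul_sum _ _ _
      _ ≤ ∑ j ∈ Finset.univ.erase i, η ^ 2 / (2 * (Fintype.card ι + 1)) :=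
        Finset.sum_le_sum fun j hj => htt i j x (Finset.ne_of_mem_erase hj).symm
      _ ≤ ∑ j : ι, η ^ 2 / (2 * (Fintype.card ι + 1)) :=
        Finset.sum_le_sum_of_subset_of_nonneg (Finset.erase_subset _ _)
          fun _ _ _ => by positivity
      _ = (Fintype.card ι) * (η ^ 2 / (2 * (Fintype.card ι + 1))) := by simp
      _ ≤ η ^ 2 / 2 := by
        rw [← mul_div_assoc, div_le_div_iff₀ (by positivity) (by positivity)]
        nlinarith [sq_nonneg η]
  refine ⟨s, fun i => ?_, fun i j hij => ?_, fun i => ?_⟩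
  · refine (ContinuousMap.norm_le _ zero_le_one).2 fun x => ?_
    rw [hs, Complex.norm_real, Real.norm_of_nonneg (hr0 i x)]
    exact hr1 i x
  · ext x
    have h : r i x * r j x = 0 := by
      rcases le_total (t i x) (t j x) with h | h
      · rw [hr_zero (h.trans (Finset.single_le_sum (f := fun k => t k x) (fun k _ => ht0 k x)
          (Finset.mem_erase.2 ⟨hij.symm, Finset.mem_univ j⟩))), zero_mul]
      · rw [hr_zero (i := j) (h.trans (Finset.single_le_sum (f := fun k => t k x)
          (fun k _ => ht0 k x) (Finset.mem_erase.2 ⟨hij, Finset.mem_univ i⟩))), mul_zero]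
    rw [ContinuousMap.mul_apply, ContinuousMap.mul_apply, ContinuousMap.mul_apply (_ * b j),
      hs, hs, mul_mul_mul_comm, ← Complex.ofReal_mul (r i x), h]
    simp
  · refine (ContinuousMap.norm_le _ hη.le).2 fun x => ?_
    rw [ContinuousMap.sub_apply, ContinuousMap.mul_apply _ (star (s i) * s i), hs, hbt,
      ← Complex.ofReal_mul, ← Complex.ofReal_sub, Complex.norm_real, ← mul_one_sub,
      Real.norm_of_nonneg (mul_nonneg (ht0 i x) (sub_nonneg.2 (hr1 i x)))]
    rcases le_total (η / 2) (t i x - S i x) with h | h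
    · have : r i x = 1 := by
        refine min_eq_left (le_max_of_le_left ?_)
        rw [div_mul_eq_mul_div, one_le_div (by positivity)]
        linarith
      simpa [this] using hη.le
    · refine (mul_le_of_le_one_right (ht0 i x) (by linarith [hr0 i x])).trans ?_
      by_contra! hlt
      have h1 := htS i x
      nlinarith [mul_le_mul_of_nonneg_left h (ht0 i x)]

/-- Almost orthogonal families of positive contractions in a commutative C*-algebra can be cut
down to exactly orthogonal ones. -/
lemma exists_orthogonal_cutdown {A ι : Type*} [CommCStarAlgebra A] [Fintype ι] {η : ℝ}
    (hη : 0 < η) (f : ι → A) (hf : ∀ i, IsPosContraction (f i))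
    (hff : ∀ i j, i ≠ j → ‖f i * f j‖ ≤ η ^ 2 / (2 * (Fintype.card ι + 1))) :
    ∃ c : ι → A, (∀ i, IsPosContraction (f i * c i)) ∧
      (∀ i j, i ≠ j → f i * c i * (f j * c j) = 0) ∧ ∀ i, ‖f i - f i * c i‖ ≤ η := by
  choose b hb using fun i => (hf i).1
  let e := gelfandStarTransform A
  have he (a : A) : ‖e a‖ = ‖a‖ := NonUnitalStarAlgHom.norm_map e e.injective a
  have hfe (i) : e (f i) = star (e (b i)) * e (b i) := by rw [hb, map_mul, map_star]
  obtain ⟨s, hs1, hs2, hs3⟩ := ContinuousMap.exists_orthogonal_cutdown hη (fun i => e (b i))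
    (fun i j hij => by rw [← hfe, ← hfe, ← map_mul, he]; exact hff i j hij)
  have hes (i) : e (star (e.symm (s i)) * e.symm (s i)) = star (s i) * s i := by
    rw [map_mul, map_star, e.apply_symm_apply]
  refine ⟨fun i => star (e.symm (s i)) * e.symm (s i), fun i => ⟨⟨b i * e.symm (s i), ?_⟩, ?_⟩,
    fun i j hij => ?_, fun i => ?_⟩
  · rw [hb, star_mul']
    ring
  · refine (norm_mul_le _ _).trans (mul_le_one₀ (hf i).2 (norm_nonneg _) ?_)
    rw [← he, hes]
    exact hs1 i
  · refine (map_eq_zero_iff e e.injective).1 ?_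
    rw [map_mul e (f i * _), map_mul e (f i), map_mul e (f j), hes, hes, hfe, hfe]
    exact hs2 i j hij
  · rw [← he, map_sub, map_mul e (f i), hes, hfe]
    exact hs3 i

/-- For a partial action `α` of a finite group `G` on a unital
*commutative* C*-algebra `A`, `dim_Rok(α) ≤ d` iff for every `ε > 0` and finite `F ⊆ A`
there are positive contractions `f g j ∈ α.dom g` with
(1) `‖α_g (f_h^{(j)} a) − f_{gh}^{(j)} α_g(a)‖ < ε` for all `a ∈ F ∩ A_{g⁻¹}`,
(2) `f_g^{(j)} f_h^{(j)} = 0` exactly for `g ≠ h`, and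
(3) `‖Σ_g Σ_j f_g^{(j)} − 1‖ < ε`. -/
theorem hasRokhlinDimLE_iff_orthogonal_towers {G : Type*} [Group G] [Fintype G]
    {A : Type*} [CommCStarAlgebra A] (α : CStarPartialAction G A) (d : ℕ) :
    HasRokhlinDimLE α d ↔
      ∀ ε > (0 : ℝ), ∀ F : Finset A, ∃ f : G → Fin (d + 1) → A,
        (∀ g j, f g j ∈ α.dom g ∧ IsPosContraction (f g j)) ∧
        (∀ g h : G, ∀ j, ∀ a ∈ F, a ∈ α.dom g⁻¹ →
          ‖α.act g (f h j * a) - f (g * h) j * α.act g a‖ < ε) ∧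
        (∀ j, ∀ g h : G, g ≠ h → f g j * f h j = 0) ∧
        (‖(∑ g : G, ∑ j : Fin (d + 1), f g j) - 1‖ < ε) := by
  classical
  constructor
  · intro H ε hε F
    have hM (a) (ha : a ∈ F) : ‖a‖ ≤ ∑ a ∈ F, ‖a‖ :=
      Finset.single_le_sum (fun a _ => norm_nonneg a) ha
    have hM0 : 0 ≤ ∑ a ∈ F, ‖a‖ := Finset.sum_nonneg fun a _ => norm_nonneg a
    set M := ∑ a ∈ F, ‖a‖
    set K : ℝ := Fintype.card G * (d + 1) with hK
    have hK0 : 0 ≤ K := by positivity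
    obtain ⟨η, hη, hηM, hηK⟩ : ∃ η > (0 : ℝ), η * M ≤ ε / 3 ∧ K * η ≤ ε / 3 := by
      have hpos : 0 < 3 * (M + K + 1) := by positivity
      refine ⟨ε / (3 * (M + K + 1)), by positivity, ?_, ?_⟩
      · rw [div_mul_eq_mul_div, div_le_div_iff₀ hpos (by norm_num)]
        nlinarith
      · rw [← mul_div_assoc, div_le_div_iff₀ hpos (by norm_num)]
        nlinarith
    obtain ⟨f, hf, h1, h2, h3, -⟩ := H (min (ε / 3) (η ^ 2 / (2 * (Fintype.card G + 1))))
      (by positivity) (insert 1 F)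
    choose c hc1 hc2 hc3 using fun j => exists_orthogonal_cutdown hη (fun g => f g j)
      (fun g => (hf g j).2) (fun g h hgh => by
        have := h2 j g h hgh 1 (Finset.mem_insert_self _ _)
        rw [mul_one] at this
        exact this.le.trans (min_le_right _ _))
    refine ⟨fun g j => f g j * c j g, fun g j => ⟨α.mul_mem_right _ _ _ (hf g j).1, hc1 j g⟩,
      fun g h j a ha hag => ?_, fun j g h hgh => hc2 j g h hgh, ?_⟩
    · have hη' (k) (y : A) (hy : ‖y‖ ≤ M) : ‖(f k j - f k j * c j k) * y‖ ≤ ε / 3 :=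
        (norm_mul_le _ _).trans ((mul_le_mul (hc3 j k) hy (norm_nonneg _) hη.le).trans hηM)
      have hm1 := α.mul_mem_left g⁻¹ (f h j) a hag
      have hm2 := α.mul_mem_left g⁻¹ (f h j * c j h) a hag
      have e1 : ‖α.act g (f h j * a) - α.act g (f h j * c j h * a)‖ ≤ ε / 3 := by
        rw [← α.act_sub g hm1 hm2, ← sub_mul]
        refine (α.norm_act_le g ?_).trans (hη' h a (hM a ha))
        exact α.mul_mem_left _ _ _ hag
      have e2 : ‖α.act g (f h j * a) - f (g * h) j * α.act g a‖ < ε / 3 := by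
        have := h1 g h j 1 (Finset.mem_insert_self _ _) a (Finset.mem_insert_of_mem ha) hag
        rw [mul_one] at this
        exact this.trans_le (min_le_left _ _)
      have e3 := hη' (g * h) (α.act g a) ((α.norm_act_le g hag).trans (hM a ha))
      calc _ = ‖-(α.act g (f h j * a) - α.act g (f h j * c j h * a)) +
              (α.act g (f h j * a) - f (g * h) j * α.act g a) +
              (f (g * h) j - f (g * h) j * c j (g * h)) * α.act g a‖ := by
            congr 1
            ring
        _ ≤ _ := norm_add₃_le
        _ < ε := by
          rw [norm_neg]
          linarith
    · have e1 : ‖(∑ j, ∑ g, f g j) - 1‖ < ε / 3 := by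
        have := h3 1 (Finset.mem_insert_self _ _)
        rw [mul_one] at this
        exact this.trans_le (min_le_left _ _)
      rw [Finset.sum_comm] at e1
      have e2 : ‖∑ g, ∑ j, (f g j - f g j * c j g)‖ ≤ K * η := by
        calc _ ≤ ∑ g : G, ∑ j : Fin (d + 1), η :=
              norm_sum_le_of_le _ fun g _ => norm_sum_le_of_le _ fun j _ => hc3 j g
          _ = K * η := by simp [hK, mul_assoc]
      calc _ = ‖((∑ g, ∑ j, f g j) - 1) - ∑ g, ∑ j, (f g j - f g j * c j g)‖ := by
            congr 1
            simp only [Finset.sum_sub_distrib]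
            ring
        _ ≤ _ := norm_sub_le _ _
        _ < ε := by linarith
  · intro H ε hε F
    have hM (a) (ha : a ∈ F) : ‖a‖ ≤ ∑ a ∈ F, ‖a‖ :=
      Finset.single_le_sum (fun a _ => norm_nonneg a) ha
    have hM0 : 0 ≤ ∑ a ∈ F, ‖a‖ := Finset.sum_nonneg fun a _ => norm_nonneg a
    set M := ∑ a ∈ F, ‖a‖
    obtain ⟨f, hf, h1, h2, h3⟩ := H (ε / (M + 1)) (by positivity) F
    have key (y a : A) (ha : a ∈ F) (hy : ‖y‖ < ε / (M + 1)) : ‖y * a‖ < ε := by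
      rw [lt_div_iff₀ (by positivity)] at hy
      have := norm_mul_le y a
      nlinarith [hM a ha, norm_nonneg y]
    refine ⟨f, hf, fun g h j a ha x hx hxg => key _ _ ha (h1 g h j x hx hxg),
      fun j g h hgh a ha => ?_, fun a ha => ?_, fun g j a ha b hb => ?_⟩
    · rw [h2 j g h hgh, zero_mul, norm_zero]
      exact hε
    · rw [Finset.sum_comm, ← sub_one_mul]
      exact key _ _ ha h3
    · rw [mul_comm (f g j), sub_self, zero_mul, norm_zero]
      exact hε
end

section
/- Let A be a unital commutative C*-algebra, let n ≥ 1, let ε > 0, and let x_1, …, x_n ∈ A be positive contractions satisfying ‖x_i x_j‖ < ε for all i ≠ j. For each i set f_i = (x_i − Σ_{j≠i} x_j)_+ (the positive part). Then each f_i is a positive contraction with f_i ≤ x_i, f_i f_j = 0 for all i ≠ j, and ‖x_i − f_i‖ ≤ n·√ε for each i. -/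
open WeakDual ComplexOrder in
/-- In a commutative C*-algebra, nonnegative elements have nonnegative real values under
characters. -/
theorem WeakDual.CharacterSpace.exists_nonneg_apply_eq {A : Type*} [CommCStarAlgebra A]
    [PartialOrder A] [StarOrderedRing A] {a : A} (ha : 0 ≤ a) (φ : characterSpace ℂ A) :
    ∃ r : ℝ, 0 ≤ r ∧ φ a = r := by
  have h : φ a ∈ spectrum ℂ a := CharacterSpace.mem_spectrum_iff_exists.mpr ⟨φ, rfl⟩
  have h0 := spectrum_nonneg_of_nonneg ha h
  exact ⟨(φ a).re, (Complex.nonneg_iff.mp h0).1, Complex.eq_re_of_ofReal_le h0⟩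

open WeakDual in
/-- Characters intertwine the positive part with the positive part of real numbers. -/
theorem WeakDual.CharacterSpace.apply_posPart {A : Type*} [CommCStarAlgebra A]
    [PartialOrder A] [StarOrderedRing A] {a : A} (ha : IsSelfAdjoint a)
    (φ : characterSpace ℂ A) {r : ℝ} (hr : φ a = r) : φ a⁺ = (max r 0 : ℝ) := by
  obtain ⟨p, hp, hp'⟩ := exists_nonneg_apply_eq (CFC.posPart_nonneg a) φ
  obtain ⟨q, hq, hq'⟩ := exists_nonneg_apply_eq (CFC.negPart_nonneg a) φ
  have hmul : p * q = 0 := by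
    have := congrArg φ (CFC.posPart_mul_negPart a)
    rw [map_mul, map_zero, hp', hq'] at this
    exact_mod_cast this
  have hsub : p - q = r := by
    have := congrArg φ (CFC.posPart_sub_negPart a ha)
    rw [map_sub, hp', hq', hr] at this
    exact_mod_cast this
  rw [hp', Complex.ofReal_inj]
  rcases mul_eq_zero.mp hmul with h | h
  · rw [max_eq_right (by linarith), h]
  · rw [max_eq_left (by linarith), ← hsub, h, sub_zero]

open WeakDual in
/-- A self-adjoint element of a commutative C*-algebra is nonnegative if its values under all
characters are. -/
theorem WeakDual.CharacterSpace.nonneg_of_forall_apply {A : Type*} [CommCStarAlgebra A]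
    [PartialOrder A] [StarOrderedRing A] {a : A} (ha : IsSelfAdjoint a)
    (h : ∀ φ : characterSpace ℂ A, ∃ r : ℝ, 0 ≤ r ∧ φ a = r) : 0 ≤ a := by
  rw [StarOrderedRing.nonneg_iff_spectrum_nonneg (R := ℝ) a ha]
  intro r hr
  rw [← spectrum.algebraMap_mem_iff ℂ, CharacterSpace.mem_spectrum_iff_exists] at hr
  obtain ⟨φ, hφ⟩ := hr
  obtain ⟨s, hs, hs'⟩ := h φ
  have : s = r := Complex.ofReal_injective (hs'.symm.trans hφ)
  exact this ▸ hs

open WeakDual in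
/-- The norm in a commutative C*-algebra is bounded by any bound on the values of characters. -/
theorem WeakDual.CharacterSpace.norm_le_of_forall_apply {A : Type*} [CommCStarAlgebra A]
    {a : A} {C : ℝ} (hC : 0 ≤ C) (h : ∀ φ : characterSpace ℂ A, ‖φ a‖ ≤ C) : ‖a‖ ≤ C := by
  rw [← (gelfandTransform_isometry A).norm_map_of_map_zero (map_zero _) a]
  exact (ContinuousMap.norm_le _ hC).mpr h

open WeakDual in
/-- Characters of a commutative C*-algebra are contractive. -/
theorem WeakDual.CharacterSpace.norm_apply_le {A : Type*} [CommCStarAlgebra A]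
    (φ : characterSpace ℂ A) (a : A) : ‖φ a‖ ≤ ‖a‖ := by
  rw [← (gelfandTransform_isometry A).norm_map_of_map_zero (map_zero _) a]
  exact (gelfandTransform ℂ A a).norm_coe_le_norm φ

theorem sub_max_sub_sum_erase_le {ι : Type*} [Fintype ι] [DecidableEq ι] {ε : ℝ}
    {t : ι → ℝ} (h : ∀ i j, i ≠ j → t i * t j < ε) (i : ι) :
    t i - max (t i - ∑ j ∈ Finset.univ.erase i, t j) 0 ≤ Fintype.card ι * √ε := by
  have hs := Real.sqrt_nonneg ε
  have hcard : (1 : ℝ) ≤ Fintype.card ι := by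
    exact_mod_cast Fintype.card_pos_iff.mpr ⟨i⟩
  rcases le_or_gt (t i) √ε with hi | hi
  · nlinarith [le_max_right (t i - ∑ j ∈ Finset.univ.erase i, t j) 0]
  · have hsum : ∑ j ∈ Finset.univ.erase i, t j ≤ (Finset.univ.erase i).card • √ε := by
      refine Finset.sum_le_card_nsmul _ _ _ fun j hj ↦ ?_
      by_contra! hj'
      have := h i j (Finset.ne_of_mem_erase hj).symm
      exact absurd (Real.lt_sq_of_sqrt_lt (lt_min hi hj')) (by
        have := min_le_left (t i) (t j)
        have := min_le_right (t i) (t j)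
        have : 0 ≤ min (t i) (t j) := hs.trans (lt_min hi hj').le
        nlinarith)
    have hle : ((Finset.univ.erase i).card : ℝ) ≤ Fintype.card ι := by
      exact_mod_cast Finset.card_le_univ _
    rw [nsmul_eq_mul] at hsum
    have := mul_le_mul_of_nonneg_right hle hs
    linarith [le_max_left (t i - ∑ j ∈ Finset.univ.erase i, t j) 0]

theorem max_sub_sum_erase_mul_eq_zero {ι : Type*} [Fintype ι] [DecidableEq ι]
    {t : ι → ℝ} (ht : ∀ i, 0 ≤ t i) {i j : ι} (hij : i ≠ j) :
    max (t i - ∑ k ∈ Finset.univ.erase i, t k) 0 *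
      max (t j - ∑ k ∈ Finset.univ.erase j, t k) 0 = 0 := by
  have hi : t j ≤ ∑ k ∈ Finset.univ.erase i, t k :=
    Finset.single_le_sum (fun k _ ↦ ht k) (by simp [hij.symm])
  have hj : t i ≤ ∑ k ∈ Finset.univ.erase j, t k :=
    Finset.single_le_sum (fun k _ ↦ ht k) (by simp [hij])
  rcases le_total (t i) (t j) with h | h
  · rw [max_eq_right (by linarith), zero_mul]
  · rw [max_eq_right (b := 0) (a := t j - _) (by linarith), mul_zero]


/-- In a unital commutative C*-algebra, if `x 0, …, x (n-1)` are positive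
contractions with `‖x i * x j‖ < ε` for `i ≠ j`, then the positive parts
`f i = (x i − Σ_{j ≠ i} x j)⁺` are positive contractions with `f i ≤ x i`, they are exactly
pairwise orthogonal, and `‖x i − f i‖ ≤ n √ε`. -/
theorem posPart_orthogonalization {A : Type*} [CommCStarAlgebra A]
    [PartialOrder A] [StarOrderedRing A]
    (n : ℕ) (hn : 1 ≤ n) (ε : ℝ) (hε : 0 < ε) (x : Fin n → A)
    (hpos : ∀ i, 0 ≤ x i) (hcontr : ∀ i, ‖x i‖ ≤ 1)
    (horth : ∀ i j, i ≠ j → ‖x i * x j‖ < ε)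
    (f : Fin n → A) (hf : ∀ i, f i = (x i - ∑ j ∈ Finset.univ.erase i, x j)⁺) :
    (∀ i, 0 ≤ f i ∧ ‖f i‖ ≤ 1) ∧
    (∀ i, f i ≤ x i) ∧
    (∀ i j, i ≠ j → f i * f j = 0) ∧
    (∀ i, ‖x i - f i‖ ≤ n * Real.sqrt ε) := by
  have hsa : ∀ i, IsSelfAdjoint (x i - ∑ j ∈ Finset.univ.erase i, x j) := fun i ↦
    (hpos i).isSelfAdjoint.sub (Finset.sum_nonneg fun j _ ↦ hpos j).isSelfAdjoint
  have hfpos : ∀ i, 0 ≤ f i := fun i ↦ hf i ▸ CFC.posPart_nonneg _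
  have key : ∀ φ : WeakDual.characterSpace ℂ A, ∃ t : Fin n → ℝ,
      (∀ i, 0 ≤ t i) ∧ (∀ i, φ (x i) = t i) ∧ (∀ i j, i ≠ j → t i * t j < ε) ∧
      ∀ i, φ (f i) = (max (t i - ∑ j ∈ Finset.univ.erase i, t j) 0 : ℝ) := by
    intro φ
    choose t ht ht' using fun i ↦ WeakDual.CharacterSpace.exists_nonneg_apply_eq (hpos i) φ
    refine ⟨t, ht, ht', fun i j hij ↦ ?_, fun i ↦ ?_⟩
    · have h := (WeakDual.CharacterSpace.norm_apply_le φ (x i * x j)).trans_lt (horth i j hij)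
      rw [map_mul, ht', ht', ← Complex.ofReal_mul, Complex.norm_real] at h
      exact (le_abs_self _).trans_lt h
    · rw [hf]
      exact WeakDual.CharacterSpace.apply_posPart (hsa i) φ (by simp [ht'])
  have hle : ∀ i, f i ≤ x i := fun i ↦ by
    rw [← sub_nonneg]
    refine WeakDual.CharacterSpace.nonneg_of_forall_apply
      ((hpos i).isSelfAdjoint.sub (hfpos i).isSelfAdjoint) fun φ ↦ ?_
    obtain ⟨t, ht, htx, -, htf⟩ := key φ
    refine ⟨_, sub_nonneg.mpr (max_le ?_ (ht i)), by rw [map_sub, htx, htf, Complex.ofReal_sub]⟩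
    exact sub_le_self _ (Finset.sum_nonneg fun j _ ↦ ht j)
  refine ⟨fun i ↦ ⟨hfpos i, ?_⟩, hle, fun i j hij ↦ ?_, fun i ↦ ?_⟩
  · exact (CStarAlgebra.norm_le_norm_of_nonneg_of_le (hfpos i) (hle i)).trans (hcontr i)
  · refine norm_le_zero_iff.mp
      (WeakDual.CharacterSpace.norm_le_of_forall_apply le_rfl fun φ ↦ ?_)
    obtain ⟨t, ht, -, -, htf⟩ := key φ
    rw [map_mul, htf, htf, ← Complex.ofReal_mul, max_sub_sum_erase_mul_eq_zero ht hij]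
    simp
  · refine WeakDual.CharacterSpace.norm_le_of_forall_apply (by positivity) fun φ ↦ ?_
    obtain ⟨t, ht, htx, hto, htf⟩ := key φ
    have hnonneg : 0 ≤ t i - max (t i - ∑ j ∈ Finset.univ.erase i, t j) 0 :=
      sub_nonneg.mpr (max_le (sub_le_self _ (Finset.sum_nonneg fun j _ ↦ ht j)) (ht i))
    rw [map_sub, htx, htf, ← Complex.ofReal_sub, Complex.norm_of_nonneg hnonneg]
    simpa using sub_max_sub_sum_erase_le hto i
end

section
/- Let A be a commutative C*-algebra, let n ≥ 1, and let J, A_1, …, A_n be closed two-sided ideals of A. Let π : A → A/J be the quotient map. For j = 1, …, n let x_j ∈ A_j be a positive contraction such that x_j x_k ∈ J for all k ≠ j. Then there exist pairwise orthogonal positive contractions y_j ∈ A_j (j = 1, …, n), i.e., y_j y_k = 0 for j ≠ k, satisfying π(y_j) = π(x_j) for all j. -/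
open WeakDual Unitization

/-- The Gelfand transform of a commutative C*-algebra, taken inside its unitization. -/
noncomputable def unitizationGelfand (A : Type*) [NonUnitalCommCStarAlgebra A] :
    A →⋆ₙₐ[ℂ] C(characterSpace ℂ (Unitization ℂ A), ℂ) :=
  (gelfandStarTransform (Unitization ℂ A) : Unitization ℂ A →⋆ₙₐ[ℂ] _).comp
    (inrNonUnitalStarAlgHom ℂ A)

section

variable {A : Type*} [NonUnitalCommCStarAlgebra A]

lemma unitizationGelfand_apply (a : A) :
    unitizationGelfand A a = gelfandStarTransform (Unitization ℂ A) (a : Unitization ℂ A) :=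
  rfl

lemma isometry_unitizationGelfand : Isometry (unitizationGelfand A) :=
  NonUnitalStarAlgHom.isometry _ <|
    (gelfandStarTransform (Unitization ℂ A)).injective.comp inr_injective

lemma norm_unitizationGelfand (a : A) : ‖unitizationGelfand A a‖ = ‖a‖ :=
  NonUnitalStarAlgHom.norm_map _ isometry_unitizationGelfand.injective a

/-- A multiplication-closed subspace is stable under multiplication by arbitrary continuous
functions on the spectrum of the unitization. -/
lemma exists_mem_unitizationGelfand_eq_mul (I : Submodule ℂ A)
    (hI : ∀ a, ∀ b ∈ I, a * b ∈ I) {b : A} (hb : b ∈ I)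
    (f : C(characterSpace ℂ (Unitization ℂ A), ℂ)) :
    ∃ c ∈ I, unitizationGelfand A c = f * unitizationGelfand A b := by
  obtain ⟨u, hu⟩ := (gelfandStarTransform (Unitization ℂ A)).surjective f
  refine ⟨u.fst • b + u.snd * b, I.add_mem (I.smul_mem _ hb) (hI _ _ hb), ?_⟩
  rw [unitizationGelfand_apply, unitizationGelfand_apply, ← hu]
  refine Eq.trans ?_ (map_mul (gelfandStarTransform (Unitization ℂ A)) u b)
  congr 1
  ext <;> simp

/-- A continuous function whose square is dominated by an element of a closed ideal belongs to
that ideal. -/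
lemma exists_mem_unitizationGelfand_eq_of_sq_le (I : Submodule ℂ A) (hIc : IsClosed (I : Set A))
    (hI : ∀ a, ∀ b ∈ I, a * b ∈ I) {b : A} (hb : b ∈ I)
    (f : C(characterSpace ℂ (Unitization ℂ A), ℂ))
    (hf : ∀ φ, ‖f φ‖ ^ 2 ≤ ‖unitizationGelfand A b φ‖) :
    ∃ c ∈ I, unitizationGelfand A c = f := by
  suffices f ∈ closure (unitizationGelfand A '' I) by
    rwa [(isometry_unitizationGelfand.isClosedEmbedding.isClosedMap _ hIc).closure_eq] at this
  refine Metric.mem_closure_iff.2 fun δ' hδ' ↦ ?_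
  obtain ⟨δ, hδ, hδδ'⟩ := exists_between hδ'
  set g := unitizationGelfand A b
  have hpos (φ) : 0 < ‖g φ‖ ^ 2 + δ ^ 4 := by positivity
  let h : C(characterSpace ℂ (Unitization ℂ A), ℂ) :=
    ⟨fun φ ↦ f φ * star (g φ) * (((‖g φ‖ ^ 2 + δ ^ 4)⁻¹ : ℝ) : ℂ), by
      have : Continuous fun φ ↦ (‖g φ‖ ^ 2 + δ ^ 4)⁻¹ :=
        Continuous.inv₀ (by fun_prop) fun φ ↦ (hpos φ).ne'
      fun_prop⟩
  obtain ⟨c, hc, hcg⟩ := exists_mem_unitizationGelfand_eq_mul I hI hb h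
  refine ⟨_, ⟨c, hc, hcg⟩, lt_of_le_of_lt ?_ hδδ'⟩
  refine (ContinuousMap.dist_le hδ.le).2 fun φ ↦ ?_
  have key : f φ - (h * g) φ = f φ * ((δ ^ 4 * (‖g φ‖ ^ 2 + δ ^ 4)⁻¹ : ℝ) : ℂ) := by
    have h1 : star (g φ) * g φ = ((‖g φ‖ ^ 2 : ℝ) : ℂ) := by
      simpa using Complex.conj_mul' (g φ)
    have h2 : (((‖g φ‖ ^ 2 : ℝ) : ℂ) + ((δ ^ 4 : ℝ) : ℂ)) *
        (((‖g φ‖ ^ 2 + δ ^ 4)⁻¹ : ℝ) : ℂ) = 1 := by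
      rw [← Complex.ofReal_add, ← Complex.ofReal_mul, mul_inv_cancel₀ (hpos φ).ne',
        Complex.ofReal_one]
    change f φ - f φ * star (g φ) * (((‖g φ‖ ^ 2 + δ ^ 4)⁻¹ : ℝ) : ℂ) * g φ = _
    rw [Complex.ofReal_mul]
    linear_combination (-f φ) * h2 - f φ * (((‖g φ‖ ^ 2 + δ ^ 4)⁻¹ : ℝ) : ℂ) * h1
  rw [dist_eq_norm, key, norm_mul, Complex.norm_real, Real.norm_of_nonneg (by positivity),
    ← mul_assoc, ← div_eq_mul_inv, div_le_iff₀ (hpos φ)]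
  have ht : 0 ≤ ‖f φ‖ := norm_nonneg _
  have h4 : ‖f φ‖ ^ 4 ≤ ‖g φ‖ ^ 2 := by
    calc ‖f φ‖ ^ 4 = (‖f φ‖ ^ 2) ^ 2 := by ring
      _ ≤ _ := by gcongr; exact hf φ
  have h3 : ‖f φ‖ * δ ^ 3 ≤ ‖f φ‖ ^ 4 + δ ^ 4 := by
    rcases le_total ‖f φ‖ δ with hle | hle
    · calc ‖f φ‖ * δ ^ 3 ≤ δ * δ ^ 3 := by gcongr
        _ = δ ^ 4 := by ring
        _ ≤ _ := le_add_of_nonneg_left (by positivity)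
    · calc ‖f φ‖ * δ ^ 3 ≤ ‖f φ‖ * ‖f φ‖ ^ 3 := by gcongr
        _ = ‖f φ‖ ^ 4 := by ring
        _ ≤ _ := le_add_of_nonneg_right (by positivity)
  calc ‖f φ‖ * δ ^ 4 = δ * (‖f φ‖ * δ ^ 3) := by ring
    _ ≤ δ * (‖g φ‖ ^ 2 + δ ^ 4) := by gcongr; linarith

lemma IsPosContraction.exists_unitizationGelfand_eq {a : A} (ha : IsPosContraction a) :
    ∃ f : C(characterSpace ℂ (Unitization ℂ A), ℝ),
      (∀ φ, 0 ≤ f φ ∧ f φ ≤ 1) ∧ ∀ φ, unitizationGelfand A a φ = f φ := by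
  obtain ⟨⟨b, rfl⟩, hn⟩ := ha
  have hb (φ) : unitizationGelfand A (star b * b) φ =
      ((‖unitizationGelfand A b φ‖ ^ 2 : ℝ) : ℂ) := by
    rw [map_mul, map_star]
    simpa using Complex.conj_mul' (unitizationGelfand A b φ)
  refine ⟨⟨fun φ ↦ ‖unitizationGelfand A b φ‖ ^ 2, by fun_prop⟩,
    fun φ ↦ ⟨by simp, ?_⟩, hb⟩
  have := (ContinuousMap.norm_coe_le_norm _ φ).trans ((norm_unitizationGelfand _).trans_le hn)
  rwa [hb, Complex.norm_real, Real.norm_of_nonneg (by positivity)] at this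

lemma isPosContraction_of_unitizationGelfand_eq {a : A}
    (f : C(characterSpace ℂ (Unitization ℂ A), ℝ)) (hf : ∀ φ, 0 ≤ f φ ∧ f φ ≤ 1)
    (ha : ∀ φ, unitizationGelfand A a φ = f φ) : IsPosContraction a := by
  constructor
  · let _ : PartialOrder A := CStarAlgebra.spectralOrder A
    have : StarOrderedRing A := CStarAlgebra.spectralOrderedRing A
    refine CStarAlgebra.nonneg_iff_eq_star_mul_self.1 (inr_nonneg_iff.1 ?_)
    obtain ⟨u, hu⟩ := (gelfandStarTransform (Unitization ℂ A)).surjective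
      ⟨fun φ ↦ (Real.sqrt (f φ) : ℂ), by fun_prop⟩
    have : (a : Unitization ℂ A) = star u * u := by
      apply (gelfandStarTransform (Unitization ℂ A)).injective
      refine Eq.trans ?_ (map_mul (gelfandStarTransform (Unitization ℂ A)) (star u) u).symm
      rw [map_star]
      change unitizationGelfand A a =
        star ((gelfandStarTransform (Unitization ℂ A)).toRingEquiv u) *
          (gelfandStarTransform (Unitization ℂ A)).toRingEquiv u
      rw [hu]
      ext φ
      simp [ha, ← Complex.ofReal_mul, Real.mul_self_sqrt (hf φ).1]
    exact this ▸ star_mul_self_nonneg u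
  · rw [← norm_unitizationGelfand, ContinuousMap.norm_le _ zero_le_one]
    intro φ
    rw [ha, Complex.norm_real, Real.norm_of_nonneg (hf φ).1]
    exact (hf φ).2

end

/-- Let `A` be a commutative C*-algebra, `J, A_1, …, A_n` closed
two-sided ideals of `A`, and `π : A → A/J` the quotient map. If `x j ∈ A_j` are positive
contractions with `x j * x k ∈ J` for `j ≠ k`, then there exist pairwise orthogonal
positive contractions `y j ∈ A_j` with `π (y j) = π (x j)` (i.e. `y j − x j ∈ J`). -/
theorem exists_orthogonal_lifts {A : Type*} [NonUnitalCommCStarAlgebra A]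
    (n : ℕ) (hn : 1 ≤ n) (J : Set A) (AI : Fin n → Set A)
    (hJclosed : IsClosed J) (hJ0 : (0 : A) ∈ J)
    (hJadd : ∀ x ∈ J, ∀ y ∈ J, x + y ∈ J)
    (hJsmul : ∀ (c : ℂ), ∀ x ∈ J, c • x ∈ J)
    (hJmul : ∀ (a : A), ∀ x ∈ J, a * x ∈ J)
    (hJstar : ∀ x ∈ J, star x ∈ J)
    (hAclosed : ∀ j, IsClosed (AI j)) (hA0 : ∀ j, (0 : A) ∈ AI j)
    (hAadd : ∀ j, ∀ x ∈ AI j, ∀ y ∈ AI j, x + y ∈ AI j)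
    (hAsmul : ∀ j (c : ℂ), ∀ x ∈ AI j, c • x ∈ AI j)
    (hAmul : ∀ j (a : A), ∀ x ∈ AI j, a * x ∈ AI j)
    (hAstar : ∀ j, ∀ x ∈ AI j, star x ∈ AI j)
    (x : Fin n → A) (hx : ∀ j, x j ∈ AI j ∧ IsPosContraction (x j))
    (hxJ : ∀ j k, j ≠ k → x j * x k ∈ J) :
    ∃ y : Fin n → A, ∀ j, y j ∈ AI j ∧ IsPosContraction (y j) ∧
      y j - x j ∈ J ∧ ∀ k, k ≠ j → y j * y k = 0 := by
  classical
  let J' : Submodule ℂ A :=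
    { carrier := J, zero_mem' := hJ0, add_mem' := fun hx hy ↦ hJadd _ hx _ hy, smul_mem' := hJsmul }
  let AI' (j : Fin n) : Submodule ℂ A :=
    { carrier := AI j, zero_mem' := hA0 j, add_mem' := fun hx hy ↦ hAadd j _ hx _ hy, smul_mem' := hAsmul j }
  choose g hg hxg using fun j ↦ (hx j).2.exists_unitizationGelfand_eq
  let s (j : Fin n) : C(characterSpace ℂ (Unitization ℂ A), ℝ) := ∑ k ∈ Finset.univ.erase j, g k
  have hs (j φ) : s j φ = ∑ k ∈ Finset.univ.erase j, g k φ := by simp [s]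
  have hs0 (j φ) : 0 ≤ s j φ := hs j φ ▸ Finset.sum_nonneg fun k _ ↦ (hg k φ).1
  have hgs (j k) (hkj : k ≠ j) (φ) : g k φ ≤ s j φ :=
    hs j φ ▸ Finset.single_le_sum (f := fun k ↦ g k φ) (fun k _ ↦ (hg k φ).1) (by simp [hkj])
  let f (j : Fin n) : C(characterSpace ℂ (Unitization ℂ A), ℝ) :=
    ⟨fun φ ↦ max (g j φ - s j φ) 0, by fun_prop⟩
  have hf (j φ) : f j φ = max (g j φ - s j φ) 0 := rfl
  have hf0 (j φ) : 0 ≤ f j φ := le_max_right _ _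
  have hfg (j φ) : f j φ ≤ g j φ := max_le (by linarith [hs0 j φ]) (hg j φ).1
  have hf1 (j φ) : f j φ ≤ 1 := (hfg j φ).trans (hg j φ).2
  have hy (j) : ∃ y ∈ AI' j, unitizationGelfand A y = ⟨fun φ ↦ (f j φ : ℂ), by fun_prop⟩ := by
    refine exists_mem_unitizationGelfand_eq_of_sq_le (AI' j) (hAclosed j) (hAmul j)
      (hx j).1 _ fun φ ↦ ?_
    rw [hxg]
    simp only [ContinuousMap.coe_mk, Complex.norm_real, Real.norm_of_nonneg (hf0 j φ),
      Real.norm_of_nonneg (hg j φ).1]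
    nlinarith [hf0 j φ, hf1 j φ, hfg j φ]
  choose y hyA hyf using hy
  refine ⟨y, fun j ↦ ⟨hyA j, isPosContraction_of_unitizationGelfand_eq (f j)
    (fun φ ↦ ⟨hf0 j φ, hf1 j φ⟩) fun φ ↦ by simp [hyf], ?_, fun k hkj ↦ ?_⟩⟩
  · have hp : ∑ k ∈ Finset.univ.erase j, x j * x k ∈ J' :=
      J'.sum_mem fun k hk ↦ hxJ j k (Finset.ne_of_mem_erase hk).symm
    have hpφ (φ) : unitizationGelfand A (∑ k ∈ Finset.univ.erase j, x j * x k) φ =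
        ((g j φ * s j φ : ℝ) : ℂ) := by
      simp [hxg, hs, mul_sub, Finset.mul_sum]
    obtain ⟨c, hc, hce⟩ := exists_mem_unitizationGelfand_eq_of_sq_le J' hJclosed hJmul hp
      (unitizationGelfand A (y j - x j)) fun φ ↦ by
        have : unitizationGelfand A (y j - x j) φ = ((f j φ - g j φ : ℝ) : ℂ) := by
          simp [hyf, hxg]
        rw [this, hpφ, Complex.norm_real, Complex.norm_real,
          Real.norm_of_nonneg (mul_nonneg (hg j φ).1 (hs0 j φ)), Real.norm_eq_abs, sq_abs, hf]
        have h1 := hs0 j φ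
        have h2 := (hg j φ).1
        rcases le_total (g j φ) (s j φ) with h | h
        · rw [max_eq_right (by linarith)]; nlinarith
        · rw [max_eq_left (by linarith)]; nlinarith
    exact isometry_unitizationGelfand.injective hce ▸ hc
  · apply isometry_unitizationGelfand.injective
    rw [map_mul, map_zero, hyf, hyf]
    ext φ
    have : f j φ = 0 ∨ f k φ = 0 := by
      rw [hf, hf, max_eq_right_iff, max_eq_right_iff]
      rcases le_total (g j φ) (g k φ) with h | h
      · exact .inl (by linarith [hgs j k hkj φ])
      · exact .inr (by linarith [hgs k j hkj.symm φ])
    simpa using this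
end
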